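/- arXiv:2105.02068 — 3 statements merged into one kernel-verified Lean document; each statement's English description precedes it below -/
import Mathlib

section
/- Let 𝔛 be a countable set and c : 𝔛 → ℝ a function with c(x) > 0 for all x, and set N(X) = #{x ∈ 𝔛 : c(x) ≤ X}. Suppose there exist real constants α, β, κ with 0 < α < β and κ ≥ 0 such that: (i) the series Z(s) = Σ_{x ∈ 𝔛} c(x)^{-s} converges absolutely for Re(s) > β; (ii) Z extends to a meromorphic function on the half-plane {Re(s) > α} whose only pole there is a simple pole at s = β, with residue ρ; (iii) Z has at most polynomial growth on every fixed closed vertical strip contained in {Re(s) > α} (i.e. for all α < σ₁ ≤ σ₂ there are C, M > 0 with |Z(s)| ≤ C(1+|s|)^M whenever σ₁ ≤ Re(s) ≤ σ₂ and |s − β| ≥ 1); and (iv) for all sufficiently small δ > 0 there is a constant C_δ with |Z(s)| ≤ C_δ (1+|s|)^κ on the vertical line Re(s) = α + δ. Then for every ε > 0 one has N(X) = ρ·X^β/β + O_ε( X^{β − (β−α)/(κ+1) + ε} ) as X → ∞. -/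
open Filter MeasureTheory Complex

/-- Inversion of the one-sided Laplace transform along a vertical line. -/
theorem laplace_inversion {σ : ℝ} {f : ℝ → ℂ} {F : ℂ → ℂ} (hf : Continuous f)
    (hneg : ∀ u ≤ 0, f u = 0)
    (hint : IntegrableOn (fun u : ℝ => f u * exp (-(σ * u))) (Set.Ioi 0))
    (hL : ∀ t : ℝ, ∫ u in Set.Ioi (0 : ℝ), f u * exp (-((σ + t * I) * u)) = F (σ + t * I))
    (hF : Integrable fun t : ℝ => F (σ + t * I)) (u : ℝ) :
    f u = (2 * Real.pi : ℂ)⁻¹ * ∫ t : ℝ, F (σ + t * I) * exp ((σ + t * I) * u) := by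
  have hpi : (0 : ℝ) < 2 * Real.pi := by positivity
  set g : ℝ → ℂ := fun u => f u * exp (-(σ * u)) with hg
  have hgc : Continuous g := by fun_prop
  have hind : ∀ k : ℝ → ℂ, (Set.Ioi (0 : ℝ)).indicator (fun v => f v * k v)
      = fun v => f v * k v := by
    intro k
    ext v
    by_cases hv : 0 < v
    · simp [hv]
    · simp [hv, hneg v (not_lt.mp hv)]
  have hgi : Integrable g := by
    rw [← integrable_indicator_iff measurableSet_Ioi, hind] at hint
    exact hint
  have hFg : ∀ ξ : ℝ, FourierTransform.fourier g ξ = F (σ + (2 * Real.pi * ξ : ℝ) * I) := by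
    intro ξ
    rw [Real.fourier_real_eq_integral_exp_smul, ← hL, ← integral_indicator measurableSet_Ioi,
      hind]
    refine integral_congr_ae (Eventually.of_forall fun v => ?_)
    simp only [hg, smul_eq_mul]
    rw [mul_left_comm, ← exp_add]
    congr 2
    push_cast
    ring
  have hFi : Integrable (FourierTransform.fourier g) := by
    rw [show FourierTransform.fourier g = fun ξ : ℝ => F (σ + (2 * Real.pi * ξ : ℝ) * I) from
      funext hFg]
    exact hF.comp_mul_left' hpi.ne'
  have hinv := hgi.fourierInv_fourier_eq hFi (v := u) hgc.continuousAt
  rw [Real.fourierInv_eq'] at hinv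
  have hfu : f u = g u * exp (σ * u) := by
    simp only [hg]
    rw [mul_assoc, ← exp_add]
    simp
  rw [hfu, ← hinv, ← integral_mul_const]
  have := Measure.integral_comp_mul_left
    (fun t : ℝ => F (σ + t * I) * exp ((σ + t * I) * u)) (2 * Real.pi)
  rw [abs_of_pos (inv_pos.mpr hpi), real_smul] at this
  push_cast at this
  rw [← this]
  refine integral_congr_ae (Eventually.of_forall fun v => ?_)
  simp only [smul_eq_mul, hFg]
  rw [mul_comm (exp _) (F _), mul_assoc, ← exp_add]
  push_cast
  congr 2
  simp
  ring

theorem exists_mul_one_add_abs_le_norm {σ : ℝ} (hσ : 0 < σ) :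
    ∃ b > (0 : ℝ), ∀ t : ℝ, b * (1 + |t|) ≤ ‖(σ + t * I : ℂ)‖ := by
  refine ⟨min σ 1 / 2, by positivity, fun t => ?_⟩
  have h1 : σ ≤ ‖(σ + t * I : ℂ)‖ := by
    simpa [abs_of_pos hσ] using abs_re_le_norm (σ + t * I : ℂ)
  have h2 : |t| ≤ ‖(σ + t * I : ℂ)‖ := by
    simpa using abs_im_le_norm (σ + t * I : ℂ)
  have h3 := min_le_left σ 1
  have h4 := min_le_right σ 1
  nlinarith [abs_nonneg t]

theorem add_mul_I_ne_zero {σ : ℝ} (hσ : 0 < σ) (t : ℝ) : (σ + t * I : ℂ) ≠ 0 := by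
  intro h
  have := congrArg re h
  simp at this
  exact hσ.ne' this

theorem integrable_norm_rpow_neg {σ : ℝ} (hσ : 0 < σ) {r : ℝ} (hr : 1 < r) :
    Integrable fun t : ℝ => ‖(σ + t * I : ℂ)‖ ^ (-r) := by
  obtain ⟨b, hb, h⟩ := exists_mul_one_add_abs_le_norm hσ
  have h1 : Integrable fun t : ℝ => b ^ (-r) * (1 + ‖t‖) ^ (-r) :=
    (integrable_one_add_norm (by simpa using hr)).const_mul _
  refine h1.mono' ?_ (Eventually.of_forall fun t => ?_)
  · exact ((by fun_prop : Continuous fun t : ℝ => ‖(σ + t * I : ℂ)‖).rpow_const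
      fun t => Or.inl (norm_ne_zero_iff.mpr (add_mul_I_ne_zero hσ t))).aestronglyMeasurable
  · rw [Real.norm_of_nonneg (by positivity), ← Real.mul_rpow hb.le (by positivity)]
    exact Real.rpow_le_rpow_of_nonpos (by positivity) (h t) (by linarith)

theorem integrable_inv_mul_sub {σ γ : ℝ} (hγ : γ < σ) (hσ : 0 < σ) :
    Integrable fun t : ℝ => ((σ + t * I : ℂ) * (σ + t * I - γ))⁻¹ := by
  have hs : ∀ t : ℝ, (σ + t * I - γ : ℂ) = (σ - γ : ℝ) + t * I := fun t => by push_cast; ring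
  have hne := fun t => add_mul_I_ne_zero (sub_pos.mpr hγ) t
  refine ((integrable_norm_rpow_neg hσ (r := 2) (by norm_num)).add
    (integrable_norm_rpow_neg (sub_pos.mpr hγ) (r := 2) (by norm_num))).mono' ?_
    (Eventually.of_forall fun t => ?_)
  · refine (Continuous.inv₀ (by fun_prop) fun t => ?_).aestronglyMeasurable
    exact mul_ne_zero (add_mul_I_ne_zero hσ t) (by rw [hs]; exact hne t)
  · rw [hs, norm_inv, norm_mul, mul_inv]
    simp only [Pi.add_apply]
    rw [Real.rpow_neg (norm_nonneg _), Real.rpow_neg (norm_nonneg _), Real.rpow_two,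
      Real.rpow_two, ← inv_pow, ← inv_pow]
    nlinarith [sq_nonneg (‖(σ + t * I : ℂ)‖⁻¹ - ‖((σ - γ : ℝ) + t * I : ℂ)‖⁻¹),
      sq_nonneg (‖(σ + t * I : ℂ)‖⁻¹), sq_nonneg (‖((σ - γ : ℝ) + t * I : ℂ)‖⁻¹)]

theorem integral_mul_exp_neg_Ioi {s : ℂ} (hs : 0 < s.re) :
    IntegrableOn (fun u : ℝ => (u : ℂ) * exp (-(s * u))) (Set.Ioi 0) ∧
      ∫ u in Set.Ioi (0 : ℝ), (u : ℂ) * exp (-(s * u)) = (s * s)⁻¹ := by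
  have hne : s ≠ 0 := by rintro rfl; simp at hs
  have hn : ∀ u : ℝ, ‖exp (-(s * u))‖ = Real.exp (-s.re * u) := fun u => by
    rw [norm_exp]; simp
  have hi : IntegrableOn (fun u : ℝ => (u : ℂ) * exp (-(s * u))) (Set.Ioi 0) := by
    have h1 := integrableOn_rpow_mul_exp_neg_mul_rpow (s := 1) (p := 1) (by norm_num) (by norm_num)
      hs
    refine Integrable.mono' h1 (by fun_prop) ?_
    filter_upwards [ae_restrict_mem measurableSet_Ioi] with u hu
    rw [norm_mul, hn, norm_real, Real.norm_of_nonneg (le_of_lt hu)]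
    simp
  refine ⟨hi, ?_⟩
  have hd : ∀ u : ℝ, HasDerivAt (fun u : ℝ => -((u : ℂ) / s + (s * s)⁻¹) * exp (-(s * u)))
      ((u : ℂ) * exp (-(s * u))) u := by
    intro u
    have e1 : HasDerivAt (fun z : ℂ => -(z / s + (s * s)⁻¹) * exp (-(s * z)))
        (-(1 / s) * exp (-(s * u)) + -(u / s + (s * s)⁻¹) * (exp (-(s * u)) * -(s * 1))) (u : ℂ) :=
      (((hasDerivAt_id (u : ℂ)).div_const s).add_const _).neg.mul
        (((hasDerivAt_id (u : ℂ)).const_mul s).neg.cexp)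
    convert e1.comp_ofReal using 1
    field_simp
    ring
  have ht : Tendsto (fun u : ℝ => -((u : ℂ) / s + (s * s)⁻¹) * exp (-(s * u))) atTop (nhds 0) := by
    rw [tendsto_zero_iff_norm_tendsto_zero]
    have h1 : Tendsto (fun u : ℝ => u ^ (1 : ℝ) * Real.exp (-s.re * u)) atTop (nhds 0) :=
      tendsto_rpow_mul_exp_neg_mul_atTop_nhds_zero _ _ hs
    have h0 : Tendsto (fun u : ℝ => u ^ (0 : ℝ) * Real.exp (-s.re * u)) atTop (nhds 0) :=
      tendsto_rpow_mul_exp_neg_mul_atTop_nhds_zero _ _ hs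
    have h2 := (h1.const_mul ‖s‖⁻¹).add (h0.const_mul ‖(s * s)⁻¹‖)
    simp only [mul_zero, add_zero, Real.rpow_one, Real.rpow_zero, one_mul] at h2
    refine squeeze_zero' (Eventually.of_forall fun _ => norm_nonneg _) ?_ h2
    filter_upwards [eventually_ge_atTop 0] with u hu
    rw [norm_mul, hn, norm_neg, ← mul_assoc, ← add_mul]
    gcongr
    refine (norm_add_le _ _).trans (le_of_eq ?_)
    rw [norm_div, norm_real, Real.norm_of_nonneg hu, div_eq_inv_mul]
  rw [integral_Ioi_of_hasDerivAt_of_tendsto' (fun u _ => hd u) hi ht]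
  simp

theorem ofReal_max_zero_eq_integral {σ : ℝ} (hσ : 0 < σ) (u : ℝ) :
    ((max u 0 : ℝ) : ℂ) = (2 * Real.pi : ℂ)⁻¹ *
      ∫ t : ℝ, ((σ + t * I : ℂ) * (σ + t * I))⁻¹ * exp ((σ + t * I) * u) := by
  have hmax : ∀ s : ℂ, ∀ u ∈ Set.Ioi (0 : ℝ),
      ((max u 0 : ℝ) : ℂ) * exp (-(s * u)) = u * exp (-(s * u)) := fun s u hu => by
    rw [max_eq_left (le_of_lt hu)]
  refine laplace_inversion (σ := σ) (f := fun u : ℝ => ((max u 0 : ℝ) : ℂ))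
    (F := fun s => (s * s)⁻¹) (by fun_prop) (fun u hu => by simp [hu]) ?_ (fun t => ?_) ?_ u
  · rw [integrableOn_congr_fun (hmax σ) measurableSet_Ioi]
    exact (integral_mul_exp_neg_Ioi (by simpa using hσ)).1
  · rw [setIntegral_congr_fun measurableSet_Ioi (hmax (σ + t * I))]
    exact (integral_mul_exp_neg_Ioi (by simpa using hσ)).2
  · simpa using integrable_inv_mul_sub (γ := 0) hσ hσ

theorem ofReal_exp_max_zero_eq_integral {σ β : ℝ} (hβ : 0 < β) (hσ : β < σ) (u : ℝ) :
    (((Real.exp (β * max u 0) - 1) / β : ℝ) : ℂ) = (2 * Real.pi : ℂ)⁻¹ *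
      ∫ t : ℝ, ((σ + t * I : ℂ) * (σ + t * I - β))⁻¹ * exp ((σ + t * I) * u) := by
  have hβ' : (β : ℂ) ≠ 0 := by exact_mod_cast hβ.ne'
  have hmax : ∀ s : ℂ, ∀ u ∈ Set.Ioi (0 : ℝ),
      (((Real.exp (β * max u 0) - 1) / β : ℝ) : ℂ) * exp (-(s * u))
        = (exp ((β - s) * u) - exp (-s * u)) / β := fun s u hu => by
    rw [max_eq_left (le_of_lt hu)]
    push_cast
    rw [div_mul_eq_mul_div, sub_mul, ← exp_add]
    ring_nf
  have hI : ∀ s : ℂ, s.re = σ →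
      IntegrableOn (fun u : ℝ => exp ((β - s) * u)) (Set.Ioi 0) ∧
      IntegrableOn (fun u : ℝ => exp (-s * u)) (Set.Ioi 0) := fun s hs =>
    ⟨integrableOn_exp_mul_complex_Ioi (by simp [hs, hσ]) 0,
      integrableOn_exp_mul_complex_Ioi (by simp [hs]; linarith) 0⟩
  refine laplace_inversion (σ := σ)
    (f := fun u : ℝ => (((Real.exp (β * max u 0) - 1) / β : ℝ) : ℂ))
    (F := fun s => (s * (s - β))⁻¹) (by fun_prop) (fun u hu => by simp [hu]) ?_ (fun t => ?_)
    (integrable_inv_mul_sub hσ (hβ.trans hσ)) u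
  · rw [integrableOn_congr_fun (hmax σ) measurableSet_Ioi]
    have := hI σ (by simp)
    exact (this.1.sub this.2).div_const _
  · rw [setIntegral_congr_fun measurableSet_Ioi (hmax (σ + t * I))]
    have hre : (σ + t * I : ℂ).re = σ := by simp
    have hne : (σ + t * I : ℂ) ≠ 0 := add_mul_I_ne_zero (hβ.trans hσ) t
    have hne' : (σ + t * I : ℂ) - β ≠ 0 := by
      have := add_mul_I_ne_zero (sub_pos.mpr hσ) t
      push_cast at this
      rwa [show (σ + t * I : ℂ) - β = σ - β + t * I by ring]
    generalize (σ + t * I : ℂ) = s at *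
    rw [integral_div, integral_sub (hI s hre).1 (hI s hre).2,
      integral_exp_mul_complex_Ioi (by simp [hre, hσ]) 0,
      integral_exp_mul_complex_Ioi (by simp [hre]; linarith) 0]
    have hne2 : (β : ℂ) - s ≠ 0 := by rw [← neg_sub]; exact neg_ne_zero.mpr hne'
    simp only [ofReal_zero, mul_zero, exp_zero]
    field_simp
    ring

/-- The average of `f` over the interval `[u, u + h]`. -/
noncomputable def forwardAverage (h : ℝ) (f : ℝ → ℝ) (u : ℝ) : ℝ :=
  h⁻¹ * ∫ t in (0 : ℝ)..h, f (u + t)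

theorem continuous_forwardAverage (h : ℝ) {f : ℝ → ℝ} (hf : Continuous f) :
    Continuous (forwardAverage h f) :=
  continuous_const.mul
    (intervalIntegral.continuous_parametric_intervalIntegral_of_continuous' (by fun_prop) _ _)

theorem le_forwardAverage {h : ℝ} (hh : 0 < h) {f : ℝ → ℝ} (hf : Continuous f) {m u : ℝ}
    (hm : ∀ v ∈ Set.Icc u (u + h), m ≤ f v) : m ≤ forwardAverage h f u := by
  have h1 : ∫ _ in (0 : ℝ)..h, m ≤ ∫ t in (0 : ℝ)..h, f (u + t) :=
    intervalIntegral.integral_mono_on hh.le (by simp)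
      (Continuous.intervalIntegrable (by fun_prop) _ _)
      fun t ht => hm _ ⟨by linarith [ht.1], by linarith [ht.2]⟩
  rw [intervalIntegral.integral_const, smul_eq_mul, sub_zero] at h1
  rw [forwardAverage, inv_mul_eq_div, le_div_iff₀ hh]
  linarith

theorem forwardAverage_le {h : ℝ} (hh : 0 < h) {f : ℝ → ℝ} (hf : Continuous f) {m u : ℝ}
    (hm : ∀ v ∈ Set.Icc u (u + h), f v ≤ m) : forwardAverage h f u ≤ m := by
  have h1 : ∫ t in (0 : ℝ)..h, f (u + t) ≤ ∫ _ in (0 : ℝ)..h, m :=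
    intervalIntegral.integral_mono_on hh.le
      (Continuous.intervalIntegrable (by fun_prop) _ _) (by simp)
      fun t ht => hm _ ⟨by linarith [ht.1], by linarith [ht.2]⟩
  rw [intervalIntegral.integral_const, smul_eq_mul, sub_zero] at h1
  rw [forwardAverage, inv_mul_eq_div, div_le_iff₀ hh]
  linarith

theorem le_iterate_forwardAverage {h : ℝ} (hh : 0 < h) {m u : ℝ} (k : ℕ) {f : ℝ → ℝ}
    (hf : Continuous f) (hm : ∀ v ∈ Set.Icc u (u + k * h), m ≤ f v) :
    m ≤ (forwardAverage h)^[k] f u := by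
  induction k generalizing f with
  | zero => exact hm u (by simp)
  | succ k ih =>
    rw [Function.iterate_succ_apply]
    refine ih (continuous_forwardAverage h hf) fun v hv => le_forwardAverage hh hf fun w hw => ?_
    push_cast at hm
    exact hm w ⟨hv.1.trans hw.1, by linarith [hv.2, hw.2]⟩

theorem iterate_forwardAverage_le {h : ℝ} (hh : 0 < h) {m u : ℝ} (k : ℕ) {f : ℝ → ℝ}
    (hf : Continuous f) (hm : ∀ v ∈ Set.Icc u (u + k * h), f v ≤ m) :
    (forwardAverage h)^[k] f u ≤ m := by
  induction k generalizing f with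
  | zero => exact hm u (by simp)
  | succ k ih =>
    rw [Function.iterate_succ_apply]
    refine ih (continuous_forwardAverage h hf) fun v hv => forwardAverage_le hh hf fun w hw => ?_
    push_cast at hm
    exact hm w ⟨hv.1.trans hw.1, by linarith [hv.2, hw.2]⟩

theorem continuous_cexp_sub_one_div {h σ : ℝ} (hh : 0 < h) (hσ : 0 < σ) :
    Continuous fun t : ℝ => (exp (h * (σ + t * I)) - 1) / (h * (σ + t * I)) :=
  Continuous.div (by fun_prop) (by fun_prop) fun t =>
    mul_ne_zero (by exact_mod_cast hh.ne') (add_mul_I_ne_zero hσ t)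

theorem norm_cexp_sub_one_div_le (z : ℂ) :
    ‖(exp z - 1) / z‖ ≤ 2 * Real.exp |z.re| * min 1 ‖z‖⁻¹ := by
  have h1 : 1 ≤ Real.exp |z.re| := Real.one_le_exp (abs_nonneg _)
  rcases eq_or_ne z 0 with rfl | hz
  · simp
  have hz' : 0 < ‖z‖ := norm_pos_iff.mpr hz
  rw [norm_div, div_le_iff₀ hz']
  rcases le_total ‖z‖ 1 with hle | hle
  · rw [min_eq_left ((one_le_inv₀ hz').mpr hle)]
    refine (norm_exp_sub_one_le hle).trans ?_
    nlinarith
  · rw [min_eq_right (inv_le_one_of_one_le₀ hle), mul_assoc, inv_mul_cancel₀ hz'.ne', mul_one]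
    refine (norm_sub_le _ _).trans ?_
    rw [norm_exp, norm_one]
    linarith [Real.exp_le_exp.mpr (le_abs_self z.re)]

theorem integrable_mul_exp_vertical {σ : ℝ} {q : ℝ → ℂ} (hq : Integrable q) (u : ℝ) :
    Integrable fun t : ℝ => q t * exp ((σ + t * I) * u) := by
  refine hq.mul_bdd (c := Real.exp (σ * u))
    (by fun_prop : Continuous _).aestronglyMeasurable (Eventually.of_forall fun t => ?_)
  rw [norm_exp]
  simp

theorem integrable_mul_cexp_sub_one_div {σ h : ℝ} (hσ : 0 < σ) (hh : 0 < h) {q : ℝ → ℂ}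
    (hq : Integrable q) :
    Integrable fun t : ℝ => q t * ((exp (h * (σ + t * I)) - 1) / (h * (σ + t * I))) := by
  refine hq.mul_bdd (c := 2 * Real.exp |h * σ|)
    (continuous_cexp_sub_one_div hh hσ).aestronglyMeasurable (Eventually.of_forall fun t => ?_)
  refine (norm_cexp_sub_one_div_le _).trans ?_
  have : (h * (σ + t * I) : ℂ).re = h * σ := by simp
  rw [this]
  exact mul_le_of_le_one_right (by positivity) (min_le_left _ _)

theorem forwardAverage_eq_integral {σ h : ℝ} (hσ : 0 < σ) (hh : 0 < h) {q : ℝ → ℂ}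
    (hq : Integrable q) {f : ℝ → ℝ}
    (hf : ∀ u, (f u : ℂ) = ∫ t : ℝ, q t * exp ((σ + t * I) * u)) (u : ℝ) :
    (forwardAverage h f u : ℂ) = ∫ t : ℝ,
      q t * ((exp (h * (σ + t * I)) - 1) / (h * (σ + t * I))) * exp ((σ + t * I) * u) := by
  have hh' : (h : ℂ) ≠ 0 := by exact_mod_cast hh.ne'
  rw [forwardAverage, ofReal_mul, ← intervalIntegral.integral_ofReal]
  simp only [hf]
  rw [intervalIntegral_integral_swap, ← integral_const_mul]
  · refine integral_congr_ae (Eventually.of_forall fun t => ?_)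
    have hne := add_mul_I_ne_zero hσ t
    simp only
    generalize (σ + t * I : ℂ) = s at *
    have : ∀ w : ℝ, q t * exp (s * ((u + w : ℝ) : ℂ)) = q t * exp (s * u) * exp (s * w) :=
      fun w => by push_cast; rw [mul_add, exp_add, mul_assoc]
    simp only [this]
    rw [intervalIntegral.integral_const_mul, integral_exp_mul_complex hne]
    simp only [ofReal_zero, mul_zero, exp_zero, ofReal_inv]
    rw [mul_comm s h]
    field_simp
  · have : IsFiniteMeasure (volume.restrict (Set.uIoc 0 h)) :=
      ⟨by simp [Set.uIoc]⟩
    have h1 : Integrable (fun p : ℝ × ℝ => (1 : ℂ) * q p.2)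
        ((volume.restrict (Set.uIoc 0 h)).prod volume) :=
      Integrable.mul_prod (f := fun _ : ℝ => (1 : ℂ)) (integrable_const _) hq
    simp only [one_mul] at h1
    refine h1.mul_bdd (c := Real.exp (|σ| * (|u| + h)))
      (by fun_prop : Continuous _).aestronglyMeasurable ?_
    have hprod : ∀ᵐ p ∂((volume.restrict (Set.uIoc 0 h)).prod (volume : Measure ℝ)),
        p.1 ∈ Set.uIoc 0 h :=
      Measure.quasiMeasurePreserving_fst.ae (ae_restrict_mem measurableSet_uIoc)
    filter_upwards [hprod] with p hp
    rw [Set.uIoc_of_le hh.le] at hp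
    rw [norm_exp]
    refine Real.exp_le_exp.mpr ?_
    have : ((σ + p.2 * I : ℂ) * ((u + p.1 : ℝ) : ℂ)).re = σ * (u + p.1) := by simp
    rw [this]
    refine (le_abs_self _).trans ?_
    rw [abs_mul]
    gcongr
    refine (abs_add_le _ _).trans ?_
    rw [abs_of_pos hp.1]
    linarith [hp.2]

theorem iterate_forwardAverage_eq_integral {σ h : ℝ} (hσ : 0 < σ) (hh : 0 < h) (k : ℕ)
    {q : ℝ → ℂ} (hq : Integrable q) {f : ℝ → ℝ}
    (hf : ∀ u, (f u : ℂ) = ∫ t : ℝ, q t * exp ((σ + t * I) * u)) :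
    Integrable (fun t : ℝ => q t * ((exp (h * (σ + t * I)) - 1) / (h * (σ + t * I))) ^ k) ∧
    ∀ u : ℝ, ((forwardAverage h)^[k] f u : ℂ) = ∫ t : ℝ,
      q t * ((exp (h * (σ + t * I)) - 1) / (h * (σ + t * I))) ^ k * exp ((σ + t * I) * u) := by
  induction k generalizing q f with
  | zero => simpa using ⟨hq, hf⟩
  | succ k ih =>
    have := ih (integrable_mul_cexp_sub_one_div hσ hh hq) (forwardAverage_eq_integral hσ hh hq hf)
    simpa only [Function.iterate_succ_apply, pow_succ', ← mul_assoc] using this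

/-- Moving the line of integration of a holomorphic function that decays in a vertical strip. -/
theorem integral_vertical_eq {a σ C : ℝ} (haσ : a ≤ σ) {H : ℂ → ℂ}
    (hd : DifferentiableOn ℂ H {s | a ≤ s.re})
    (hb : ∀ s : ℂ, a ≤ s.re → s.re ≤ σ → 1 ≤ |s.im| → ‖H s‖ ≤ C / |s.im|)
    (hia : Integrable fun t : ℝ => H (a + t * I))
    (hiσ : Integrable fun t : ℝ => H (σ + t * I)) :
    ∫ t : ℝ, H (a + t * I) = ∫ t : ℝ, H (σ + t * I) := by
  have hhor : ∀ ε : ℝ, |ε| = 1 →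
      Tendsto (fun T : ℝ => ∫ x in a..σ, H (x + (ε * T : ℝ) * I)) atTop (nhds 0) := by
    intro ε hε
    have h0 : Tendsto (fun T : ℝ => C / T * |σ - a|) atTop (nhds 0) := by
      simpa using (tendsto_const_nhds.div_atTop tendsto_id : Tendsto (fun T : ℝ => C / T)
        atTop (nhds 0)).mul_const |σ - a|
    refine squeeze_zero_norm' ?_ h0
    filter_upwards [eventually_ge_atTop 1] with T hT
    refine intervalIntegral.norm_integral_le_of_norm_le_const fun x hx => ?_
    rw [Set.uIoc_of_le haσ] at hx
    have him : |(x + (ε * T : ℝ) * I : ℂ).im| = T := by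
      simp [abs_mul, hε, abs_of_pos (zero_lt_one.trans_le hT)]
    have hre : (x + (ε * T : ℝ) * I : ℂ).re = x := by simp
    have := hb (x + (ε * T : ℝ) * I) (by rw [hre]; exact hx.1.le) (by rw [hre]; exact hx.2)
      (by rw [him]; exact hT)
    rwa [him] at this
  have hrect : ∀ T : ℝ, (∫ x in a..σ, H (x + (-1 * T : ℝ) * I))
      - (∫ x in a..σ, H (x + (1 * T : ℝ) * I)) + I * (∫ y in (-T)..T, H (σ + y * I))
      - I * (∫ y in (-T)..T, H (a + y * I)) = 0 := by
    intro T
    have := integral_boundary_rect_eq_zero_of_differentiableOn H ⟨a, -1 * T⟩ ⟨σ, 1 * T⟩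
      (hd.mono fun s hs => by
        have h1 := hs.1
        simp only [Set.mem_preimage, Set.uIcc_of_le haσ] at h1
        exact h1.1)
    simpa using this
  have hlim := ((((hhor (-1) (by simp)).sub (hhor 1 (by simp))).add
    ((intervalIntegral_tendsto_integral hiσ tendsto_neg_atTop_atBot tendsto_id).const_mul I)).sub
    ((intervalIntegral_tendsto_integral hia tendsto_neg_atTop_atBot tendsto_id).const_mul I))
  simp only [id] at hlim
  rw [tendsto_congr hrect] at hlim
  have h := tendsto_nhds_unique hlim tendsto_const_nhds
  have h2 : I * ((∫ t : ℝ, H (σ + t * I)) - ∫ t : ℝ, H (a + t * I)) = 0 := by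
    rw [mul_sub, ← h]
    ring
  rcases mul_eq_zero.mp h2 with h3 | h3
  · exact absurd h3 I_ne_zero
  · exact (sub_eq_zero.mp h3).symm

theorem norm_inv_two_pi_le_one : ‖(2 * Real.pi : ℂ)⁻¹‖ ≤ 1 := by
  rw [norm_inv]
  refine inv_le_one_of_one_le₀ ?_
  rw [norm_mul, norm_real, Real.norm_of_nonneg Real.pi_pos.le]
  simp only [norm_ofNat]
  linarith [Real.pi_gt_three]

theorem min_one_pow_le_rpow {y r : ℝ} (hy : 0 < y) (hr : 0 ≤ r) {K : ℕ} (hK : r ≤ K) :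
    min 1 y ^ K ≤ y ^ r := by
  have hm : 0 < min 1 y := lt_min one_pos hy
  calc min 1 y ^ K = min 1 y ^ (K : ℝ) := (Real.rpow_natCast _ _).symm
    _ ≤ min 1 y ^ r := Real.rpow_le_rpow_of_exponent_ge hm (min_le_left _ _) hK
    _ ≤ y ^ r := Real.rpow_le_rpow hm.le (min_le_right _ _) hr

theorem norm_smoothed_le_on_line {a κ η C h u : ℝ} (ha : 0 < a) (hκ : 0 ≤ κ) (hη : 0 < η)
    (hC : 0 ≤ C) (hh : 0 < h) (hh1 : h ≤ 1) {K : ℕ} (hK : κ + η ≤ K) {s w : ℂ} (hs : s.re = a)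
    (hw : ‖w‖ ≤ C * (1 + ‖s‖) ^ κ) :
    ‖(2 * Real.pi : ℂ)⁻¹ * (w / s) * ((exp (h * s) - 1) / (h * s)) ^ K * exp (s * u)‖ ≤
      C * (1 + a⁻¹) ^ κ * (2 * Real.exp a) ^ K * Real.exp (a * u) * h ^ (-(κ + η))
        * ‖s‖ ^ (-(1 + η)) := by
  have hsn : a ≤ ‖s‖ := hs ▸ re_le_norm s
  have hs0 : 0 < ‖s‖ := ha.trans_le hsn
  have hpi := norm_inv_two_pi_le_one
  have h1 : ‖w‖ ≤ C * ((1 + a⁻¹) ^ κ * ‖s‖ ^ κ) := by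
    refine hw.trans ?_
    rw [← Real.mul_rpow (by positivity) hs0.le]
    gcongr
    have : 1 ≤ a⁻¹ * ‖s‖ := by rw [inv_mul_eq_div, one_le_div ha]; exact hsn
    linarith
  have h2 : ‖((exp (h * s) - 1) / (h * s)) ^ K‖ ≤
      (2 * Real.exp a) ^ K * (h ^ (-(κ + η)) * ‖s‖ ^ (-(κ + η))) := by
    have e1 : ‖(exp (h * s) - 1) / (h * s)‖ ≤ 2 * Real.exp a * min 1 (h * ‖s‖)⁻¹ := by
      refine (norm_cexp_sub_one_div_le _).trans ?_
      have : (h * s : ℂ).re = h * a := by simp [hs]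
      rw [this, norm_mul, norm_real, Real.norm_of_nonneg hh.le, abs_of_pos (by positivity)]
      have : h * a ≤ a := by nlinarith
      gcongr
    rw [norm_pow]
    calc _ ≤ (2 * Real.exp a * min 1 (h * ‖s‖)⁻¹) ^ K := by gcongr
      _ = (2 * Real.exp a) ^ K * (min 1 (h * ‖s‖)⁻¹) ^ K := mul_pow _ _ _
      _ ≤ (2 * Real.exp a) ^ K * ((h * ‖s‖)⁻¹) ^ (κ + η) := by
        gcongr
        exact min_one_pow_le_rpow (by positivity) (by positivity) hK
      _ = _ := by
        rw [Real.inv_rpow (by positivity), ← Real.rpow_neg (by positivity),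
          Real.mul_rpow hh.le hs0.le]
  have h3 : ‖exp (s * u)‖ = Real.exp (a * u) := by rw [norm_exp]; simp [hs]
  have h4 : ‖s‖ ^ (-(1 + η)) = ‖s‖ ^ κ * ‖s‖⁻¹ * ‖s‖ ^ (-(κ + η)) := by
    rw [← Real.rpow_neg_one, ← Real.rpow_add hs0, ← Real.rpow_add hs0]
    congr 1
    ring
  rw [norm_mul, norm_mul, norm_mul, norm_div, h3, h4]
  calc _ ≤ 1 * (C * ((1 + a⁻¹) ^ κ * ‖s‖ ^ κ) / ‖s‖) *
        ((2 * Real.exp a) ^ K * (h ^ (-(κ + η)) * ‖s‖ ^ (-(κ + η)))) * Real.exp (a * u) := by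
        gcongr
    _ = _ := by ring

theorem norm_smoothed_le_on_strip {a σ M C h u : ℝ} (ha : 0 < a) (hC : 0 ≤ C)
    (hh : 0 < h) (hh1 : h ≤ 1) {K : ℕ} (hK : M ≤ K) {s w : ℂ} (hs : a ≤ s.re) (hsσ : s.re ≤ σ)
    (him : 1 ≤ |s.im|) (hw : ‖w‖ ≤ C * (1 + ‖s‖) ^ M) :
    ‖(2 * Real.pi : ℂ)⁻¹ * (w / s) * ((exp (h * s) - 1) / (h * s)) ^ K * exp (s * u)‖ ≤
      C * 2 ^ K * (2 * Real.exp σ * h⁻¹) ^ K * Real.exp (σ * |u|) / |s.im| := by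
  have hims : |s.im| ≤ ‖s‖ := abs_im_le_norm s
  have hs0 : 0 < ‖s‖ := by linarith
  have hre : 0 < s.re := ha.trans_le hs
  have hpi := norm_inv_two_pi_le_one
  have h1 : ‖w‖ ≤ C * (2 ^ K * ‖s‖ ^ K) := by
    refine hw.trans ?_
    rw [← mul_pow]
    gcongr
    calc (1 + ‖s‖) ^ M ≤ (1 + ‖s‖) ^ (K : ℝ) :=
          Real.rpow_le_rpow_of_exponent_le (by linarith) hK
      _ = (1 + ‖s‖) ^ K := Real.rpow_natCast _ _
      _ ≤ (2 * ‖s‖) ^ K := by gcongr; linarith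
  have h2 : ‖((exp (h * s) - 1) / (h * s)) ^ K‖ ≤
      (2 * Real.exp σ * h⁻¹) ^ K * (‖s‖ ^ K)⁻¹ := by
    rw [norm_pow, ← inv_pow, ← mul_pow]
    gcongr
    refine (norm_cexp_sub_one_div_le _).trans ?_
    have : (h * s : ℂ).re = h * s.re := by simp
    rw [this, norm_mul, norm_real, Real.norm_of_nonneg hh.le, abs_of_pos (by positivity),
      mul_assoc _ h⁻¹, ← mul_inv]
    have : h * s.re ≤ σ := by nlinarith
    gcongr
    exact min_le_right _ _
  have h3 : ‖exp (s * u)‖ ≤ Real.exp (σ * |u|) := by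
    rw [norm_exp]
    refine Real.exp_le_exp.mpr ?_
    have : (s * u : ℂ).re = s.re * u := by simp
    rw [this]
    have := le_abs_self u
    have := abs_nonneg u
    nlinarith
  rw [norm_mul, norm_mul, norm_mul, norm_div]
  calc _ ≤ 1 * (C * (2 ^ K * ‖s‖ ^ K) / ‖s‖) *
        ((2 * Real.exp σ * h⁻¹) ^ K * (‖s‖ ^ K)⁻¹) * Real.exp (σ * |u|) := by
        gcongr
    _ = C * 2 ^ K * (2 * Real.exp σ * h⁻¹) ^ K * Real.exp (σ * |u|) / ‖s‖ := by
        field_simp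
    _ ≤ _ := by gcongr

/-- The smoothed difference quotient of a function with Laplace transform `W s / s ^ 2` is small
when `W` is holomorphic to the left and has controlled growth. -/
theorem exists_abs_iterate_forwardAverage_le {a σ κ η M C₁ C₂ C₃ : ℝ} {W : ℂ → ℂ} {p : ℝ → ℝ}
    (ha : 0 < a) (haσ : a ≤ σ) (hκ : 0 ≤ κ) (hη : 0 < η) (hC₁ : 0 ≤ C₁) (hC₂ : 0 ≤ C₂)
    (hd : DifferentiableOn ℂ W {s | a ≤ s.re})
    (hstrip : ∀ s : ℂ, a ≤ s.re → s.re ≤ σ → 1 ≤ |s.im| → ‖W s‖ ≤ C₁ * (1 + ‖s‖) ^ M)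
    (hline : ∀ s : ℂ, s.re = a → ‖W s‖ ≤ C₂ * (1 + ‖s‖) ^ κ)
    (hbdd : ∀ s : ℂ, s.re = σ → ‖W s‖ ≤ C₃)
    (hp : ∀ u, (p u : ℂ) = (2 * Real.pi : ℂ)⁻¹ * ∫ t : ℝ, W (σ + t * I) *
      ((σ + t * I : ℂ) * (σ + t * I))⁻¹ * exp ((σ + t * I) * u)) :
    ∃ (K : ℕ) (B : ℝ), 0 ≤ B ∧ ∀ h : ℝ, 0 < h → h ≤ 1 → ∀ u : ℝ,
      |(forwardAverage h)^[K] (fun v => (p (v + h) - p v) / h) u| ≤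
        B * Real.exp (a * u) * h ^ (-(κ + η)) := by
  have hσ : 0 < σ := ha.trans_le haσ
  obtain ⟨K, hK⟩ := exists_nat_ge (max M (κ + η))
  have hKM : M ≤ (K + 1 : ℕ) := by
    push_cast
    linarith [le_max_left M (κ + η)]
  have hKκ : κ + η ≤ (K + 1 : ℕ) := by
    push_cast
    linarith [le_max_right M (κ + η)]
  have hWc : ∀ b, a ≤ b → Continuous fun t : ℝ => W (b + t * I) := fun b hb => by
    refine hd.continuousOn.comp_continuous (by fun_prop) fun t => ?_
    simpa using hb
  have hq0 : Integrable fun t : ℝ => W (σ + t * I) * ((σ + t * I : ℂ) * (σ + t * I))⁻¹ := by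
    have := integrable_inv_mul_sub (γ := 0) hσ hσ
    simp only [ofReal_zero, sub_zero] at this
    exact this.bdd_mul (hWc σ haσ).aestronglyMeasurable
      (Eventually.of_forall fun t => hbdd _ (by simp))
  set N : ℝ := ∫ t : ℝ, ‖(a + t * I : ℂ)‖ ^ (-(1 + η)) with hN
  have hNi := integrable_norm_rpow_neg ha (r := 1 + η) (by linarith)
  refine ⟨K, C₂ * (1 + a⁻¹) ^ κ * (2 * Real.exp a) ^ (K + 1) * N, ?_, fun h hh hh1 u => ?_⟩
  · have : 0 ≤ N := integral_nonneg fun t => by positivity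
    positivity
  have hhc : (h : ℂ) ≠ 0 := by exact_mod_cast hh.ne'
  set H : ℂ → ℂ := fun s => (2 * Real.pi : ℂ)⁻¹ * (W s / s) *
    ((exp (h * s) - 1) / (h * s)) ^ (K + 1) * exp (s * u) with hH
  have hs0 : ∀ s : ℂ, a ≤ s.re → s ≠ 0 := by
    rintro s hs rfl
    simp at hs
    linarith
  have hHd : DifferentiableOn ℂ H {s | a ≤ s.re} := by
    refine DifferentiableOn.mul (DifferentiableOn.mul (DifferentiableOn.mul (by fun_prop)
      (hd.div differentiableOn_id hs0)) (DifferentiableOn.pow (DifferentiableOn.div (by fun_prop)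
      (by fun_prop) fun s hs => mul_ne_zero hhc (hs0 s hs)) _)) (by fun_prop)
  have hHc : ∀ b, a ≤ b → Continuous fun t : ℝ => H (b + t * I) := fun b hb => by
    refine hHd.continuousOn.comp_continuous (by fun_prop) fun t => ?_
    simpa using hb
  have hφ : ∀ t : ℝ, (2 * Real.pi : ℂ)⁻¹ * (W (σ + t * I) * ((σ + t * I : ℂ) * (σ + t * I))⁻¹) *
      ((exp (h * (σ + t * I)) - 1) / h) = (2 * Real.pi : ℂ)⁻¹ * (W (σ + t * I) / (σ + t * I)) *
        ((exp (h * (σ + t * I)) - 1) / (h * (σ + t * I))) := fun t => by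
    have := add_mul_I_ne_zero hσ t
    field_simp
  have hq1 : Integrable fun t : ℝ => (2 * Real.pi : ℂ)⁻¹ * (W (σ + t * I) / (σ + t * I)) *
        ((exp (h * (σ + t * I)) - 1) / (h * (σ + t * I))) := by
    simp only [← hφ]
    refine (hq0.const_mul _).mul_bdd (c := (Real.exp (h * σ) + 1) / h)
      (by fun_prop : Continuous _).aestronglyMeasurable (Eventually.of_forall fun t => ?_)
    rw [norm_div, norm_real, Real.norm_of_nonneg hh.le]
    gcongr
    refine (norm_sub_le _ _).trans ?_
    rw [norm_exp]
    simp
  have hf : ∀ v : ℝ, (((p (v + h) - p v) / h : ℝ) : ℂ) = ∫ t : ℝ,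
      (2 * Real.pi : ℂ)⁻¹ * (W (σ + t * I) / (σ + t * I)) *
        ((exp (h * (σ + t * I)) - 1) / (h * (σ + t * I))) * exp ((σ + t * I) * v) := by
    intro v
    rw [ofReal_div, ofReal_sub, hp, hp, ← mul_sub, ← integral_sub
      (integrable_mul_exp_vertical hq0 _) (integrable_mul_exp_vertical hq0 _), div_eq_mul_inv,
      mul_right_comm, ← integral_const_mul]
    refine integral_congr_ae (Eventually.of_forall fun t => ?_)
    simp only
    rw [← hφ]
    generalize (σ + t * I : ℂ) = s
    push_cast
    rw [mul_add, exp_add, mul_comm (h : ℂ) s]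
    ring
  obtain ⟨hint, heq⟩ := iterate_forwardAverage_eq_integral hσ hh K hq1 hf
  have hHeq : ∀ t : ℝ, (2 * Real.pi : ℂ)⁻¹ * (W (σ + t * I) / (σ + t * I)) *
        ((exp (h * (σ + t * I)) - 1) / (h * (σ + t * I))) *
        ((exp (h * (σ + t * I)) - 1) / (h * (σ + t * I))) ^ K * exp ((σ + t * I) * u)
        = H (σ + t * I) := fun t => by
    simp only [hH]
    ring
  have hbound : ∀ t : ℝ, ‖H (a + t * I)‖ ≤ C₂ * (1 + a⁻¹) ^ κ * (2 * Real.exp a) ^ (K + 1) *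
      Real.exp (a * u) * h ^ (-(κ + η)) * ‖(a + t * I : ℂ)‖ ^ (-(1 + η)) := fun t =>
    norm_smoothed_le_on_line ha hκ hη hC₂ hh hh1 hKκ (by simp) (hline _ (by simp))
  have hHa : Integrable fun t : ℝ => H (a + t * I) :=
    (hNi.const_mul _).mono' (hHc a le_rfl).aestronglyMeasurable (Eventually.of_forall hbound)
  have hHσ : Integrable fun t : ℝ => H (σ + t * I) := by
    have := integrable_mul_exp_vertical (σ := σ) hint u
    simpa only [hHeq] using this
  have hshift := integral_vertical_eq haσ hHd (fun s hs hsσ him =>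
    norm_smoothed_le_on_strip ha hC₁ hh hh1 hKM hs hsσ him (hstrip s hs hsσ him)) hHa hHσ
  have hval := heq u
  simp only [hHeq] at hval
  rw [← hshift] at hval
  rw [← Real.norm_eq_abs, ← norm_real, hval]
  refine (norm_integral_le_of_norm_le (hNi.const_mul _) (Eventually.of_forall hbound)).trans ?_
  rw [integral_const_mul, ← hN]
  apply le_of_eq
  ring

theorem continuous_of_eq_integral_vertical {σ : ℝ} {q : ℝ → ℂ} (hq : Integrable q) {f : ℝ → ℝ}
    (hf : ∀ u, (f u : ℂ) = ∫ t : ℝ, q t * exp ((σ + t * I) * u)) : Continuous f := by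
  have hc : Continuous fun u : ℝ => ∫ t : ℝ, q t * exp ((σ + t * I) * u) := by
    rw [continuous_iff_continuousAt]
    intro u
    refine continuousAt_of_dominated (bound := fun t => ‖q t‖ * Real.exp (|σ| * (|u| + 1)))
      (Eventually.of_forall fun v => (integrable_mul_exp_vertical hq v).aestronglyMeasurable)
      ?_ (hq.norm.mul_const _) (Eventually.of_forall fun t => by fun_prop)
    filter_upwards [Metric.ball_mem_nhds u one_pos] with v hv
    refine Eventually.of_forall fun t => ?_
    rw [norm_mul, norm_exp]
    gcongr
    have : ((σ + t * I : ℂ) * v).re = σ * v := by simp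
    rw [this]
    refine (le_abs_self _).trans ?_
    rw [abs_mul]
    gcongr
    rw [Metric.mem_ball, Real.dist_eq] at hv
    linarith [abs_sub_abs_le_abs_sub v u]
  have : f = fun u : ℝ => (∫ t : ℝ, q t * exp ((σ + t * I) * u)).re := by
    ext u
    rw [← hf, ofReal_re]
  rw [this]
  exact continuous_re.comp hc

theorem ofReal_cpow_neg_mul_exp {y : ℝ} (hy : 0 < y) (s : ℂ) (u : ℝ) :
    (y : ℂ) ^ (-s) * exp (s * u) = exp (s * ((u - Real.log y : ℝ) : ℂ)) := by
  rw [cpow_def_of_ne_zero (by exact_mod_cast hy.ne'), ← exp_add, ← ofReal_log hy.le]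
  push_cast
  congr 1
  ring

theorem norm_ofReal_cpow_neg {y : ℝ} (hy : 0 < y) (s : ℂ) :
    ‖(y : ℂ) ^ (-s)‖ = y ^ (-s.re) := by
  rw [norm_cpow_eq_rpow_re_of_pos hy, neg_re]

theorem hasSum_max_sub_log {𝔛 : Type*} [Countable 𝔛] {c : 𝔛 → ℝ} (hc : ∀ x, 0 < c x) {σ : ℝ}
    (hσ : 0 < σ) (hsum : Summable fun x => c x ^ (-σ)) (u : ℝ) :
    HasSum (fun x => ((max (u - Real.log (c x)) 0 : ℝ) : ℂ)) ((2 * Real.pi : ℂ)⁻¹ *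
      ∫ t : ℝ, (∑' x, (c x : ℂ) ^ (-(σ + t * I : ℂ))) * ((σ + t * I : ℂ) * (σ + t * I))⁻¹ *
        exp ((σ + t * I) * u)) := by
  have hi : Integrable fun t : ℝ => ((σ + t * I : ℂ) * (σ + t * I))⁻¹ := by
    simpa using integrable_inv_mul_sub (γ := 0) hσ hσ
  have hnorm : ∀ x, ∀ t : ℝ,
      ‖((σ + t * I : ℂ) * (σ + t * I))⁻¹ * exp ((σ + t * I) * ((u - Real.log (c x) : ℝ) : ℂ))‖
        = ‖((σ + t * I : ℂ) * (σ + t * I))⁻¹‖ * (c x ^ (-σ) * Real.exp (σ * u)) := by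
    intro x t
    rw [norm_mul, ← ofReal_cpow_neg_mul_exp (hc x), norm_mul, norm_ofReal_cpow_neg (hc x), norm_exp]
    simp
  have key := hasSum_integral_of_summable_integral_norm (μ := volume)
    (F := fun x (t : ℝ) => ((σ + t * I : ℂ) * (σ + t * I))⁻¹ *
      exp ((σ + t * I) * ((u - Real.log (c x) : ℝ) : ℂ)))
    (fun x => integrable_mul_exp_vertical hi _) (by
      simp only [hnorm, integral_mul_const]
      exact (hsum.mul_right _).mul_left _)
  have := key.mul_left (2 * Real.pi : ℂ)⁻¹
  simp only [← ofReal_max_zero_eq_integral hσ] at this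
  have e : ∀ s : ℂ, (∑' x, (c x : ℂ) ^ (-s)) * (s * s)⁻¹ * exp (s * u) =
      ∑' x, (s * s)⁻¹ * exp (s * ((u - Real.log (c x) : ℝ) : ℂ)) := fun s => by
    rw [tsum_mul_left, mul_right_comm, ← tsum_mul_right, mul_comm]
    simp only [ofReal_cpow_neg_mul_exp (hc _)]
  simp only [e]
  exact this

theorem finite_setOf_le {𝔛 : Type*} {c : 𝔛 → ℝ} (hc : ∀ x, 0 < c x) {σ : ℝ}
    (hσ : 0 < σ) (hsum : Summable fun x => c x ^ (-σ)) {X : ℝ} (hX : 0 < X) :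
    {x | c x ≤ X}.Finite := by
  have h := hsum.tendsto_cofinite_zero.eventually_lt_const (Real.rpow_pos_of_pos hX (-σ))
  refine (Filter.eventually_cofinite.mp h).subset fun x hx => ?_
  simp only [Set.mem_ofPred_eq, not_lt]
  exact Real.rpow_le_rpow_of_nonpos (hc x) hx (by linarith)

theorem card_mul_le_and_le_card_mul {𝔛 : Type*} {c : 𝔛 → ℝ} (hc : ∀ x, 0 < c x)
    (hfin : ∀ X > (0 : ℝ), {x | c x ≤ X}.Finite) (v : ℝ) {h : ℝ} (hh : 0 < h) :
    (Nat.card {x // c x ≤ Real.exp v} : ℝ) * h ≤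
        (∑' x, max (v + h - Real.log (c x)) 0) - ∑' x, max (v - Real.log (c x)) 0 ∧
      (∑' x, max (v + h - Real.log (c x)) 0) - ∑' x, max (v - Real.log (c x)) 0 ≤
        (Nat.card {x // c x ≤ Real.exp (v + h)} : ℝ) * h := by
  classical
  set S := (hfin _ (Real.exp_pos (v + h))).toFinset with hS
  have hlog : ∀ x w, c x ≤ Real.exp w ↔ Real.log (c x) ≤ w := fun x w =>
    (Real.log_le_iff_le_exp (hc x)).symm
  have hmem : ∀ x, x ∈ S ↔ Real.log (c x) ≤ v + h := fun x => by simp [hS, hlog]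
  have hts : ∀ w ≤ v + h, ∑' x, max (w - Real.log (c x)) 0
      = ∑ x ∈ S, max (w - Real.log (c x)) 0 := fun w hw => by
    refine tsum_eq_sum fun x hx => max_eq_right ?_
    rw [hmem, not_le] at hx
    linarith
  have hcard : ∀ w ≤ v + h, (Nat.card {x // c x ≤ Real.exp w} : ℝ) * h
      = ∑ x ∈ S, if Real.log (c x) ≤ w then h else 0 := fun w hw => by
    have : {x | c x ≤ Real.exp w} = ↑(S.filter fun x => Real.log (c x) ≤ w) := by
      ext x
      simp only [Set.mem_ofPred_eq, Finset.coe_filter, hmem, hlog]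
      exact ⟨fun h => ⟨h.trans hw, h⟩, fun h => h.2⟩
    have h2 : Nat.card {x // c x ≤ Real.exp w}
        = (S.filter fun x => Real.log (c x) ≤ w).card := by
      rw [← Set.ncard_coe_finset, ← this]
      rfl
    rw [h2, ← Finset.sum_filter, Finset.sum_const, nsmul_eq_mul]
  rw [hts _ le_rfl, hts v (by linarith), hcard v (by linarith), hcard _ le_rfl,
    ← Finset.sum_sub_distrib]
  constructor <;> refine Finset.sum_le_sum fun x hx => ?_
  · split_ifs with hx'
    · rw [max_eq_left (by linarith), max_eq_left (by linarith)]
      linarith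
    · have := max_le_max_right 0 (by linarith : v - Real.log (c x) ≤ v + h - Real.log (c x))
      linarith
  · rw [if_pos ((hmem x).mp hx), max_eq_left (by linarith [(hmem x).mp hx])]
    linarith [le_max_left (v - Real.log (c x)) 0]

theorem exp_mul_le_div_and_div_le {β h v : ℝ} (hβ : 0 < β) (hh : 0 < h) (hv : 0 ≤ v) :
    Real.exp (β * v) ≤ ((Real.exp (β * max (v + h) 0) - 1) / β -
        (Real.exp (β * max v 0) - 1) / β) / h ∧
      ((Real.exp (β * max (v + h) 0) - 1) / β - (Real.exp (β * max v 0) - 1) / β) / h ≤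
        Real.exp (β * (v + h)) := by
  rw [max_eq_left hv, max_eq_left (by linarith), ← sub_div, div_div]
  have h1 : Real.exp (β * (v + h)) = Real.exp (β * v) * Real.exp (β * h) := by
    rw [← Real.exp_add]
    ring_nf
  have h2 : Real.exp (β * v) = Real.exp (β * (v + h)) * Real.exp (-(β * h)) := by
    rw [← Real.exp_add]
    ring_nf
  constructor
  · rw [le_div_iff₀ (by positivity), h1]
    nlinarith [Real.add_one_le_exp (β * h), Real.exp_pos (β * v)]
  · rw [div_le_iff₀ (by positivity)]
    nlinarith [Real.add_one_le_exp (-(β * h)), Real.exp_pos (β * (v + h))]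

theorem abs_exp_sub_exp_le {β L u y : ℝ} (hy₁ : Real.exp (β * (u - L)) ≤ y)
    (hy₂ : y ≤ Real.exp (β * (u + L))) (hL : 0 ≤ β * L) :
    |y - Real.exp (β * u)| ≤ β * L * Real.exp (β * L) * Real.exp (β * u) := by
  have e1 : Real.exp (β * (u - L)) = Real.exp (β * u) * Real.exp (-(β * L)) := by
    rw [← Real.exp_add]
    ring_nf
  have e2 : Real.exp (β * (u + L)) = Real.exp (β * u) * Real.exp (β * L) := by
    rw [← Real.exp_add]
    ring_nf
  have e3 : Real.exp (β * L) * Real.exp (-(β * L)) = 1 := by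
    rw [← Real.exp_add]
    simp
  have hp := Real.exp_pos (β * u)
  have f1 := Real.add_one_le_exp (-(β * L))
  have f2 := Real.one_le_exp hL
  have f3 : Real.exp (β * L) - 1 ≤ β * L * Real.exp (β * L) := by
    nlinarith [Real.exp_pos (β * L)]
  have f4 : β * L ≤ β * L * Real.exp (β * L) := le_mul_of_one_le_right hL f2
  rw [abs_le]
  constructor <;> nlinarith

/-- A counting function is close to `r * exp (β * u)` when the smoothed remainder is small. -/
theorem abs_count_sub_le {β r h : ℝ} (hβ : 0 < β) (hh : 0 < h) (hh1 : h ≤ 1)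
    {n P p : ℝ → ℝ} (hn : Monotone n)
    (hP : ∀ v, n v * h ≤ P (v + h) - P v ∧ P (v + h) - P v ≤ n (v + h) * h)
    (hp : ∀ v, p v = P v - r * ((Real.exp (β * max v 0) - 1) / β)) (hpc : Continuous p) (K : ℕ)
    {u : ℝ} (hu : K + 1 ≤ u) {B : ℝ}
    (hB : ∀ w ≤ u, |(forwardAverage h)^[K] (fun v => (p (v + h) - p v) / h) w| ≤ B) :
    |n u - r * Real.exp (β * u)| ≤ B + 1 +
      |r| * (β * ((K + 1) * h) * Real.exp (β * (K + 1)) * Real.exp (β * u)) := by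
  set E : ℝ → ℝ := fun v => (p (v + h) - p v) / h with hE
  set Q : ℝ → ℝ := fun v => ((Real.exp (β * max (v + h) 0) - 1) / β -
    (Real.exp (β * max v 0) - 1) / β) / h with hQ
  have hEc : Continuous E := by fun_prop
  set L : ℝ := (K + 1) * h with hL
  have hK0 : (0 : ℝ) ≤ K := K.cast_nonneg
  have hL0 : 0 < L := by positivity
  have hL1 : L ≤ K + 1 := by nlinarith
  have hEQ : ∀ v, E v = (P (v + h) - P v) / h - r * Q v := fun v => by
    simp only [hE, hQ, hp]
    ring
  have hn1 : ∀ v, n v ≤ E v + r * Q v := fun v => by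
    rw [hEQ, sub_add_cancel, le_div_iff₀ hh]
    exact (hP v).1
  have hn2 : ∀ v, E v + r * Q v ≤ n (v + h) := fun v => by
    rw [hEQ, sub_add_cancel, div_le_iff₀ hh]
    exact (hP v).2
  have hQb : ∀ v, u - L ≤ v → v + h ≤ u + L →
      |r * Q v - r * Real.exp (β * u)| ≤
        |r| * (β * L * Real.exp (β * (K + 1)) * Real.exp (β * u)) := by
    intro v hv₁ hv₂
    obtain ⟨q1, q2⟩ := exp_mul_le_div_and_div_le hβ hh (by linarith : 0 ≤ v)
    rw [← mul_sub, abs_mul]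
    gcongr
    refine (abs_exp_sub_exp_le (L := L) (le_trans (Real.exp_le_exp.mpr ?_) q1)
      (q2.trans (Real.exp_le_exp.mpr ?_)) (by positivity)).trans ?_
    · exact mul_le_mul_of_nonneg_left hv₁ hβ.le
    · exact mul_le_mul_of_nonneg_left hv₂ hβ.le
    · gcongr
  obtain ⟨v, hv, hEv⟩ : ∃ v ∈ Set.Icc u (u + K * h), E v < B + 1 := by
    by_contra! hcon
    have := le_iterate_forwardAverage hh K hEc hcon
    linarith [(abs_le.mp (hB u le_rfl)).2]
  obtain ⟨w, hw, hEw⟩ : ∃ w ∈ Set.Icc (u - L) (u - L + K * h), -(B + 1) < E w := by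
    by_contra! hcon
    have := iterate_forwardAverage_le hh K hEc hcon
    linarith [(abs_le.mp (hB (u - L) (by linarith))).1]
  have hLh : L = K * h + h := by rw [hL]; ring
  have b1 := abs_le.mp (hQb v (by linarith [hv.1]) (by linarith [hv.2]))
  have b2 := abs_le.mp (hQb w hw.1 (by linarith [hw.2]))
  have m1 := hn hv.1
  have m2 := hn (show w + h ≤ u by linarith [hw.2])
  rw [abs_le]
  constructor
  · linarith [hn2 w, b2.1]
  · linarith [hn1 v, b1.2]

theorem isBigO_of_exp_bound {f : ℝ → ℝ} {θ C u₀ : ℝ}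
    (hf : ∀ u ≥ u₀, |f (Real.exp u)| ≤ C * Real.exp (θ * u)) :
    f =O[atTop] fun X : ℝ => X ^ θ := by
  refine Asymptotics.IsBigO.of_bound C ?_
  filter_upwards [eventually_ge_atTop (Real.exp u₀)] with X hX
  have hX0 : 0 < X := (Real.exp_pos _).trans_le hX
  have := hf (Real.log X) ((Real.le_log_iff_exp_le hX0).mpr hX)
  rw [Real.exp_log hX0] at this
  rw [Real.norm_eq_abs, Real.norm_of_nonneg (by positivity), Real.rpow_def_of_pos hX0,
    mul_comm (Real.log X)]
  exact this

/-- Tauberian theorem with power savings: analytic properties of the conductor zeta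
function `Z(s) = Σ_{x ∈ 𝔛} c(x)^{-s}` imply a counting law for
`N(X) = #{x ∈ 𝔛 : c(x) ≤ X}`. -/
theorem tauberian_power_savings
    (𝔛 : Type*) [Countable 𝔛] (c : 𝔛 → ℝ) (hc : ∀ x, 0 < c x)
    (α β κ ρ : ℝ) (hα : 0 < α) (hαβ : α < β) (hκ : 0 ≤ κ)
    (Z : ℂ → ℂ)
    -- (i) absolute convergence of the series for `Re(s) > β`, and `Z` agrees with it there
    (hconv : ∀ s : ℂ, β < s.re → Summable fun x : 𝔛 => ‖(c x : ℂ) ^ (-s)‖)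
    (hZval : ∀ s : ℂ, β < s.re → Z s = ∑' x : 𝔛, (c x : ℂ) ^ (-s))
    -- (ii) meromorphic continuation to `Re(s) > α` with a unique, simple pole at
    -- `s = β` of residue `ρ`
    (hmero : ∃ G : ℂ → ℂ, AnalyticOn ℂ G {s : ℂ | α < s.re} ∧
      ∀ s : ℂ, α < s.re → s ≠ (β : ℂ) → Z s = G s + (ρ : ℂ) / (s - (β : ℂ)))
    -- (iii) polynomial growth on closed vertical strips inside `Re(s) > α`, away from the pole
    (hgrowth : ∀ σ₁ σ₂ : ℝ, α < σ₁ → σ₁ ≤ σ₂ → ∃ C M : ℝ, 0 < C ∧ 0 < M ∧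
      ∀ s : ℂ, σ₁ ≤ s.re → s.re ≤ σ₂ → 1 ≤ ‖s - (β : ℂ)‖ →
        ‖Z s‖ ≤ C * (1 + ‖s‖) ^ M)
    -- (iv) growth `(1+|s|)^κ` on vertical lines `Re(s) = α + δ` for all small `δ > 0`
    (hline : ∃ δ₀ > (0 : ℝ), ∀ δ ∈ Set.Ioo (0 : ℝ) δ₀, ∃ Cδ > (0 : ℝ),
      ∀ s : ℂ, s.re = α + δ → ‖Z s‖ ≤ Cδ * (1 + ‖s‖) ^ κ) :
    ∀ ε > (0 : ℝ),
      (fun X : ℝ => (Nat.card {x : 𝔛 // c x ≤ X} : ℝ) - ρ * X ^ β / β)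
        =O[atTop] fun X : ℝ => X ^ (β - (β - α) / (κ + 1) + ε) := by
  intro ε hε
  obtain ⟨G, hGa, hG⟩ := hmero
  obtain ⟨δ₀, hδ₀, hline⟩ := hline
  obtain ⟨δ, hδ0, hδ1, hδε, hδβ⟩ : ∃ δ : ℝ, 0 < δ ∧ δ < δ₀ ∧ δ ≤ ε / 2 ∧ α + δ < β := by
    have hm : 0 < min δ₀ (min ε (β - α)) := lt_min hδ₀ (lt_min hε (by linarith))
    have m1 := min_le_left δ₀ (min ε (β - α))
    have m2 := (min_le_right δ₀ (min ε (β - α))).trans (min_le_left _ _)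
    have m3 := (min_le_right δ₀ (min ε (β - α))).trans (min_le_right _ _)
    exact ⟨min δ₀ (min ε (β - α)) / 2, by linarith, by linarith, by linarith, by linarith⟩
  obtain ⟨C₂, hC₂, hline⟩ := hline δ ⟨hδ0, hδ1⟩
  set a := α + δ with ha
  set σ := β + 1 with hσ
  have ha0 : 0 < a := by linarith
  have hβ : 0 < β := by linarith
  have hβc : (β : ℂ) ≠ 0 := by exact_mod_cast hβ.ne'
  have hσ0 : 0 < σ := by linarith
  obtain ⟨C₁, M, hC₁, hM, hstrip⟩ := hgrowth a σ (by linarith) (by linarith)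
  set r := ρ / β with hr
  set W : ℂ → ℂ := fun s => G s - r with hW
  have hZW : ∀ s : ℂ, a ≤ s.re → s ≠ β → W s = Z s - (ρ : ℂ) / (s - β) - r := fun s hs hne => by
    rw [hG s (by linarith) hne]
    ring
  have hWle : ∀ s : ℂ, a ≤ s.re → s ≠ β → ‖W s‖ ≤ ‖Z s‖ + |ρ| / ‖s - β‖ + |r| := by
    intro s hs hne
    rw [hZW s hs hne]
    refine (norm_sub_le _ _).trans ?_
    rw [norm_real, Real.norm_eq_abs]
    gcongr
    refine (norm_sub_le _ _).trans ?_
    rw [norm_div, norm_real, Real.norm_eq_abs]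
  have hWd : DifferentiableOn ℂ W {s | a ≤ s.re} := by
    refine DifferentiableOn.sub_const ?_ _
    refine hGa.differentiableOn.mono fun s hs => ?_
    have hs' : a ≤ s.re := hs
    exact (by linarith : α < s.re)
  have hne_of_re : ∀ s : ℂ, s.re ≠ β → s ≠ β := by
    rintro s hs rfl
    simp at hs
  have hWstrip : ∀ s : ℂ, a ≤ s.re → s.re ≤ σ → 1 ≤ |s.im| →
      ‖W s‖ ≤ (C₁ + |ρ| + |r|) * (1 + ‖s‖) ^ M := by
    intro s hs hsσ him
    have h1 : 1 ≤ ‖s - β‖ := him.trans (by simpa using abs_im_le_norm (s - β))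
    have hne : s ≠ β := by
      rintro rfl
      simp at him
      linarith
    have h2 : 1 ≤ (1 + ‖s‖) ^ M := Real.one_le_rpow (by linarith [norm_nonneg s]) hM.le
    have h3 : |ρ| / ‖s - β‖ ≤ |ρ| := div_le_self (abs_nonneg _) h1
    have h4 := hstrip s hs hsσ h1
    have h5 := hWle s hs hne
    nlinarith [abs_nonneg ρ, abs_nonneg r]
  have hWline : ∀ s : ℂ, s.re = a →
      ‖W s‖ ≤ (C₂ + |ρ| / (β - a) + |r|) * (1 + ‖s‖) ^ κ := by
    intro s hs
    have h0 : 0 < β - a := by linarith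
    have h1 : β - a ≤ ‖s - β‖ := by
      have := abs_re_le_norm (s - β)
      simp only [sub_re, ofReal_re, hs] at this
      rw [abs_sub_comm, abs_of_pos h0] at this
      exact this
    have h2 : 1 ≤ (1 + ‖s‖) ^ κ := Real.one_le_rpow (by linarith [norm_nonneg s]) hκ
    have h3 : |ρ| / ‖s - β‖ ≤ |ρ| / (β - a) := by gcongr
    have h4 := hline s hs
    have h5 := hWle s hs.ge (hne_of_re s (by linarith))
    have h6 : 0 ≤ |ρ| / (β - a) := by positivity
    nlinarith [abs_nonneg r]
  have hsum : Summable fun x => c x ^ (-σ) := by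
    have := hconv σ (by simp [hσ])
    simpa only [norm_ofReal_cpow_neg (hc _), ofReal_re] using this
  have hWbdd : ∀ s : ℂ, s.re = σ → ‖W s‖ ≤ (∑' x, c x ^ (-σ)) + |ρ| + |r| := by
    intro s hs
    have h1 : 1 ≤ ‖s - β‖ := by
      have := abs_re_le_norm (s - β)
      simpa [hs, hσ] using this
    have h3 : |ρ| / ‖s - β‖ ≤ |ρ| := div_le_self (abs_nonneg _) h1
    have h4 : ‖Z s‖ ≤ ∑' x, c x ^ (-σ) := by
      rw [hZval s (by linarith)]
      refine (norm_tsum_le_tsum_norm (hconv s (by linarith))).trans (le_of_eq ?_)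
      simp only [norm_ofReal_cpow_neg (hc _), hs]
    have h5 := hWle s (by linarith) (hne_of_re s (by linarith))
    linarith
  set P : ℝ → ℝ := fun u => ∑' x, max (u - Real.log (c x)) 0 with hP
  set p : ℝ → ℝ := fun u => P u - r * ((Real.exp (β * max u 0) - 1) / β) with hp
  have hWi : Integrable fun t : ℝ => W (σ + t * I) * ((σ + t * I : ℂ) * (σ + t * I))⁻¹ := by
    have := integrable_inv_mul_sub (γ := 0) hσ0 hσ0
    simp only [ofReal_zero, sub_zero] at this
    refine this.bdd_mul (c := (∑' x, c x ^ (-σ)) + |ρ| + |r|) ?_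
      (Eventually.of_forall fun t => hWbdd _ (by simp))
    refine (hWd.continuousOn.comp_continuous (by fun_prop) fun t => ?_).aestronglyMeasurable
    show a ≤ (σ + t * I : ℂ).re
    simp
    linarith
  have hpint : ∀ u, (p u : ℂ) = (2 * Real.pi : ℂ)⁻¹ * ∫ t : ℝ, W (σ + t * I) *
      ((σ + t * I : ℂ) * (σ + t * I))⁻¹ * exp ((σ + t * I) * u) := by
    intro u
    have h1 := (hasSum_max_sub_log hc hσ0 hsum u).tsum_eq
    have h2 := ofReal_exp_max_zero_eq_integral hβ (by linarith : β < σ) u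
    have hi2 : Integrable fun t : ℝ =>
        (r : ℂ) * (((σ + t * I : ℂ) * (σ + t * I - β))⁻¹ * exp ((σ + t * I) * u)) :=
      (integrable_mul_exp_vertical (integrable_inv_mul_sub (by linarith : β < σ) hσ0) u).const_mul _
    have hpt : ∀ t : ℝ, (∑' x, (c x : ℂ) ^ (-(σ + t * I : ℂ))) *
        ((σ + t * I : ℂ) * (σ + t * I))⁻¹ * exp ((σ + t * I) * u) =
        W (σ + t * I) * ((σ + t * I : ℂ) * (σ + t * I))⁻¹ * exp ((σ + t * I) * u) +
        (r : ℂ) * (((σ + t * I : ℂ) * (σ + t * I - β))⁻¹ * exp ((σ + t * I) * u)) := by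
      intro t
      have hre : (σ + t * I : ℂ).re = σ := by simp
      have hne := add_mul_I_ne_zero hσ0 t
      have hne' := hne_of_re (σ + t * I) (by rw [hre]; linarith)
      generalize (σ + t * I : ℂ) = s at *
      rw [hZW s (by linarith) hne', ← hZval s (by linarith)]
      have := sub_ne_zero.mpr hne'
      simp only [hr, ofReal_div]
      field_simp
      ring
    simp only [hpt] at h1
    rw [integral_add (integrable_mul_exp_vertical hWi u) hi2, mul_add, integral_const_mul] at h1
    simp only [hp, hP]
    rw [ofReal_sub, ofReal_mul, ofReal_tsum, h1, h2]
    ring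
  have hpc : Continuous p := by
    refine continuous_of_eq_integral_vertical (σ := σ) (hWi.const_mul (2 * Real.pi : ℂ)⁻¹)
      fun u => ?_
    rw [hpint, ← integral_const_mul]
    simp only [mul_assoc]
  set ω := (β - α) / (κ + 1) with hω
  have hω0 : 0 < ω := div_pos (by linarith) (by linarith)
  have hκω : κ * ω = β - α - ω := by
    rw [hω]
    field_simp
    ring
  obtain ⟨K, B, hB, hbound⟩ := exists_abs_iterate_forwardAverage_le (η := ε / (2 * ω)) ha0
    (by linarith : a ≤ σ) hκ (by positivity) (by positivity)
    (add_nonneg (add_nonneg hC₂.le (div_nonneg (abs_nonneg _) (by linarith))) (abs_nonneg _))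
    hWd hWstrip hWline hWbdd hpint
  have hfin : ∀ X > (0 : ℝ), {x | c x ≤ X}.Finite := fun X hX => finite_setOf_le hc hσ0 hsum hX
  have hmono : Monotone fun u : ℝ => (Nat.card {x // c x ≤ Real.exp u} : ℝ) := by
    intro u v huv
    simp only [Nat.cast_le]
    exact Set.ncard_le_ncard (fun x (hx : c x ≤ _) => hx.trans (Real.exp_le_exp.mpr huv))
      (hfin _ (Real.exp_pos v))
  refine isBigO_of_exp_bound (u₀ := K + 1)
    (C := B + 1 + |r| * (β * (K + 1) * Real.exp (β * (K + 1)))) fun u hu => ?_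
  have hu0 : 0 ≤ u := le_trans (by positivity) hu
  have hh1 : Real.exp (-(ω * u)) ≤ 1 := Real.exp_le_one_iff.mpr (by nlinarith)
  have key := abs_count_sub_le hβ (Real.exp_pos (-(ω * u))) hh1 hmono
    (fun v => card_mul_le_and_le_card_mul hc hfin v (Real.exp_pos _)) (fun v => rfl) hpc K hu
    (B := B * Real.exp (a * u) * Real.exp (-(ω * u)) ^ (-(κ + ε / (2 * ω)))) fun w hw =>
      (hbound _ (Real.exp_pos _) hh1 w).trans (by gcongr)
  have hωβ : ω ≤ β := by
    rw [hω, div_le_iff₀ (by linarith)]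
    nlinarith
  have e0 : Real.exp u ^ β = Real.exp (β * u) := by rw [← Real.exp_mul, mul_comm]
  have e1 : Real.exp (a * u) * Real.exp (-(ω * u)) ^ (-(κ + ε / (2 * ω))) ≤
      Real.exp ((β - ω + ε) * u) := by
    rw [← Real.exp_mul, ← Real.exp_add]
    refine Real.exp_le_exp.mpr ?_
    have : a * u + -(ω * u) * -(κ + ε / (2 * ω)) = (a + κ * ω + ε / 2) * u := by
      field_simp
      ring
    rw [this, hκω]
    exact mul_le_mul_of_nonneg_right (by linarith) hu0
  have e2 : 1 ≤ Real.exp ((β - ω + ε) * u) :=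
    Real.one_le_exp (mul_nonneg (by linarith) hu0)
  have e3 : Real.exp (-(ω * u)) * Real.exp (β * u) ≤ Real.exp ((β - ω + ε) * u) := by
    rw [← Real.exp_add]
    refine Real.exp_le_exp.mpr ?_
    nlinarith
  rw [e0, mul_div_right_comm]
  refine key.trans ?_
  have hD : 0 ≤ |r| * (β * (K + 1) * Real.exp (β * (K + 1))) := by positivity
  calc _ = B * (Real.exp (a * u) * Real.exp (-(ω * u)) ^ (-(κ + ε / (2 * ω)))) + 1 +
        |r| * (β * (K + 1) * Real.exp (β * (K + 1))) *
          (Real.exp (-(ω * u)) * Real.exp (β * u)) := by ring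
    _ ≤ B * Real.exp ((β - ω + ε) * u) + Real.exp ((β - ω + ε) * u) +
        |r| * (β * (K + 1) * Real.exp (β * (K + 1))) * Real.exp ((β - ω + ε) * u) := by gcongr
    _ = _ := by ring
end

section
/- Let s be the multiplicative arithmetic function determined by s(1) = 1, s(p) = 1 − 3/p², s(p²) = 1 − 3/p² + 3/p⁴, and s(p^α) = (1 − 1/p²)³ for every prime p and every integer α ≥ 3. Then, as X → ∞, Σ_{1 ≤ N ≤ X} N² s(N) = X³/(3 ζ(3)³) + O(X²), where ζ is the Riemann zeta function. -/
open Filter ArithmeticFunction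

namespace ArithmeticFunction

lemma coe_moebius_mul_apply_prime_pow_succ {R : Type*} [CommRing R] (f : ArithmeticFunction R)
    {p : ℕ} (hp : p.Prime) (k : ℕ) :
    ((moebius : ArithmeticFunction R) * f) (p ^ (k + 1)) = f (p ^ (k + 1)) - f (p ^ k) := by
  have key : ∀ j, ∑ i ∈ Finset.range (j + 1), ((moebius : ArithmeticFunction R) * f) (p ^ i)
      = f (p ^ j) := fun j ↦ by
    rw [← Nat.sum_divisors_prime_pow hp, ← coe_zeta_mul_apply, ← mul_assoc,
      coe_zeta_mul_coe_moebius, one_mul]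
  rw [← key (k + 1), ← key k, Finset.sum_range_succ _ (k + 1)]
  ring

lemma coe_moebius_mul_apply_one {R : Type*} [CommRing R] (f : ArithmeticFunction R) :
    ((moebius : ArithmeticFunction R) * f) 1 = f 1 := by
  simp

/-- The threefold Dirichlet convolution of the Möbius function. -/
def moebiusCube : ArithmeticFunction ℤ := moebius * (moebius * moebius)

lemma moebiusCube_mul_pow_two_apply (s : ArithmeticFunction ℝ) (hmul : s.IsMultiplicative)
    (hp1 : ∀ p : ℕ, p.Prime → s p = 1 - 3 / (p : ℝ) ^ 2)
    (hp2 : ∀ p : ℕ, p.Prime → s (p ^ 2) = 1 - 3 / (p : ℝ) ^ 2 + 3 / (p : ℝ) ^ 4)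
    (hp3 : ∀ p α : ℕ, p.Prime → 3 ≤ α → s (p ^ α) = (1 - 1 / (p : ℝ) ^ 2) ^ 3) (n : ℕ) :
    ((moebiusCube : ArithmeticFunction ℝ) * ((pow 2 : ArithmeticFunction ℕ) :
      ArithmeticFunction ℝ)) n = (n : ℝ) ^ 2 * s n := by
  set F : ArithmeticFunction ℝ := ((pow 2 : ArithmeticFunction ℕ) : ArithmeticFunction ℝ) with hF
  have hFn : ∀ m : ℕ, F m = (m : ℝ) ^ 2 := fun m ↦ by simp [hF, natCoe_apply, pow_apply]
  have hFm : F.IsMultiplicative := isMultiplicative_pow.natCast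
  have hμ : (moebius : ArithmeticFunction ℝ).IsMultiplicative := isMultiplicative_moebius.intCast
  have hassoc : (moebiusCube : ArithmeticFunction ℝ) * F =
      (moebius : ArithmeticFunction ℝ) * ((moebius : ArithmeticFunction ℝ) *
        ((moebius : ArithmeticFunction ℝ) * F)) := by
    rw [moebiusCube, intCoe_mul, intCoe_mul, mul_assoc, mul_assoc]
  suffices h : (moebiusCube : ArithmeticFunction ℝ) * F = F.pmul s by
    rw [h, pmul_apply, hFn]
  rw [hassoc, IsMultiplicative.eq_iff_eq_on_prime_powers _ (hμ.mul (hμ.mul (hμ.mul hFm))) _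
    (hFm.pmul hmul)]
  intro p k hp
  have hp0 : (p : ℝ) ≠ 0 := by exact_mod_cast hp.ne_zero
  rcases k with _ | _ | _ | k
  · simp only [pow_zero, coe_moebius_mul_apply_one, pmul_apply, hmul.map_one, mul_one]
  · simp only [coe_moebius_mul_apply_prime_pow_succ _ hp, pow_zero, coe_moebius_mul_apply_one,
      pmul_apply, hFn]
    rw [zero_add, pow_one, hp1 p hp]
    push_cast
    field_simp
    ring
  · simp only [coe_moebius_mul_apply_prime_pow_succ _ hp, pow_zero, coe_moebius_mul_apply_one,
      pmul_apply, hFn, zero_add, hp2 p hp, show 1 + 1 = 2 from rfl]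
    push_cast
    field_simp
    ring
  · simp only [coe_moebius_mul_apply_prime_pow_succ _ hp, pmul_apply, hFn,
      hp3 p (k + 1 + 1 + 1) hp (by omega)]
    push_cast
    field_simp
    ring

lemma LSeriesSummable_moebiusCube {z : ℂ} (hz : 1 < z.re) :
    LSeriesSummable (fun n ↦ ((moebiusCube : ArithmeticFunction ℂ) n)) z := by
  have h := LSeriesSummable_moebius_iff.mpr hz
  simp only [← intCoe_apply] at h
  rw [moebiusCube, intCoe_mul, intCoe_mul]
  exact LSeriesSummable_mul h (LSeriesSummable_mul h h)

lemma LSeries_moebiusCube {z : ℂ} (hz : 1 < z.re) :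
    LSeries (fun n ↦ ((moebiusCube : ArithmeticFunction ℂ) n)) z = ((riemannZeta z) ^ 3)⁻¹ := by
  have h := LSeriesSummable_moebius_iff.mpr hz
  have h1 := LSeries_zeta_mul_Lseries_moebius hz
  simp only [← intCoe_apply] at h h1
  rw [LSeries_zeta_eq_riemannZeta hz] at h1
  rw [moebiusCube, intCoe_mul, intCoe_mul, LSeries_mul' h (LSeriesSummable_mul h h),
    LSeries_mul' h h, eq_inv_of_mul_eq_one_right h1]
  ring

lemma term_moebiusCube (k n : ℕ) :
    LSeries.term (fun n ↦ ((moebiusCube : ArithmeticFunction ℂ) n)) k n =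
      (((moebiusCube n : ℝ) / (n : ℝ) ^ k : ℝ) : ℂ) := by
  rcases eq_or_ne n 0 with rfl | hn
  · simp
  · rw [LSeries.term_of_ne_zero hn, Complex.cpow_natCast, intCoe_apply]
    push_cast
    rfl

lemma summable_moebiusCube_div_pow {k : ℕ} (hk : 1 < k) :
    Summable fun n : ℕ ↦ (moebiusCube n : ℝ) / (n : ℝ) ^ k := by
  have h := LSeriesSummable_moebiusCube (z := k) (by simpa using hk)
  rw [LSeriesSummable, funext fun n ↦ term_moebiusCube k n] at h
  exact Complex.summable_ofReal.mp h

lemma tsum_moebiusCube_div_pow {k : ℕ} (hk : 1 < k) :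
    ∑' n : ℕ, (moebiusCube n : ℝ) / (n : ℝ) ^ k = ((∑' n : ℕ, ((n : ℝ) ^ k)⁻¹) ^ 3)⁻¹ := by
  have h := LSeries_moebiusCube (z := k) (by simpa using hk)
  rw [LSeries, funext fun n ↦ term_moebiusCube k n, ← Complex.ofReal_tsum,
    zeta_nat_eq_tsum_of_gt_one hk] at h
  apply Complex.ofReal_injective
  rw [h]
  push_cast
  simp

end ArithmeticFunction

lemma sum_Ioc_sq (n : ℕ) :
    ∑ m ∈ Finset.Ioc 0 n, (m : ℝ) ^ 2 = (n : ℝ) ^ 3 / 3 + (n : ℝ) ^ 2 / 2 + n / 6 := by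
  induction n with
  | zero => simp
  | succ n ih =>
    rw [Finset.sum_Ioc_succ_top (Nat.zero_le n), ih]
    push_cast
    ring

lemma abs_sum_Ioc_floor_sq_sub_le {y : ℝ} (hy : 0 ≤ y) :
    |∑ m ∈ Finset.Ioc 0 ⌊y⌋₊, (m : ℝ) ^ 2 - y ^ 3 / 3| ≤ y ^ 2 := by
  rw [sum_Ioc_sq]
  have h1 := Nat.floor_le hy
  have h2 := Nat.lt_floor_add_one y
  have h3 : (⌊y⌋₊ : ℝ) ≤ (⌊y⌋₊ : ℝ) ^ 2 := by exact_mod_cast Nat.le_self_pow two_ne_zero _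
  have h0 : (0 : ℝ) ≤ ⌊y⌋₊ := Nat.cast_nonneg _
  generalize (⌊y⌋₊ : ℝ) = n at *
  have h4 : n ^ 2 ≤ y ^ 2 := by gcongr
  have h5 : n ^ 3 ≤ y ^ 3 := by gcongr
  have h6 : y ^ 3 - n ^ 3 ≤ 3 * y ^ 2 := by
    have : (y - n) * (y ^ 2 + y * n + n ^ 2) ≤ 1 * (3 * y ^ 2) := by
      apply mul_le_mul <;> nlinarith
    linarith
  rw [abs_le]
  constructor <;> nlinarith

/-- For the multiplicative arithmetic function `s` with `s(p) = 1 - 3/p²`,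
`s(p²) = 1 - 3/p² + 3/p⁴` and `s(p^α) = (1 - 1/p²)³` for `α ≥ 3`, one has
`Σ_{N ≤ X} N² s(N) = X³/(3ζ(3)³) + O(X²)` as `X → ∞`. -/
theorem sum_N_sq_s_asymptotic
    (s : ArithmeticFunction ℝ) (hmul : s.IsMultiplicative)
    (hp1 : ∀ p : ℕ, p.Prime → s p = 1 - 3 / (p : ℝ) ^ 2)
    (hp2 : ∀ p : ℕ, p.Prime → s (p ^ 2) = 1 - 3 / (p : ℝ) ^ 2 + 3 / (p : ℝ) ^ 4)
    (hp3 : ∀ p α : ℕ, p.Prime → 3 ≤ α → s (p ^ α) = (1 - 1 / (p : ℝ) ^ 2) ^ 3) :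
    (fun X : ℝ => (∑ N ∈ Finset.Icc 1 ⌊X⌋₊, (N : ℝ) ^ 2 * s N) -
        X ^ 3 / (3 * (∑' n : ℕ, ((n : ℝ) ^ 3)⁻¹) ^ 3))
      =O[atTop] fun X : ℝ => X ^ 2 := by
  have hs2 := (summable_moebiusCube_div_pow (k := 2) (by norm_num)).norm
  have hs3 := summable_moebiusCube_div_pow (k := 3) (by norm_num)
  refine Asymptotics.IsBigO.of_bound (∑' n : ℕ, ‖(moebiusCube n : ℝ) / (n : ℝ) ^ 2‖) ?_
  filter_upwards [eventually_ge_atTop 0] with X hX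
  set S : ℕ → ℝ := fun d ↦ ∑ m ∈ Finset.Ioc 0 ⌊X / d⌋₊, (m : ℝ) ^ 2 with hS
  have hsum : HasSum (fun d ↦ (moebiusCube d : ℝ) * S d)
      (∑ N ∈ Finset.Icc 1 ⌊X⌋₊, (N : ℝ) ^ 2 * s N) := by
    have hfin : ∑ N ∈ Finset.Icc 1 ⌊X⌋₊, (N : ℝ) ^ 2 * s N =
        ∑ d ∈ Finset.Ioc 0 ⌊X⌋₊, (moebiusCube d : ℝ) * S d := by
      simp_rw [← moebiusCube_mul_pow_two_apply s hmul hp1 hp2 hp3]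
      rw [show Finset.Icc 1 ⌊X⌋₊ = Finset.Ioc 0 ⌊X⌋₊ from rfl, sum_Ioc_mul_eq_sum_sum]
      simp [hS, Nat.floor_div_natCast, natCoe_apply, pow_apply]
    rw [hfin]
    refine hasSum_sum_of_ne_finset_zero fun d hd ↦ ?_
    rcases Nat.eq_zero_or_pos d with rfl | hd0
    · simp
    · have : ⌊X⌋₊ < d := by simpa [hd0] using hd
      simp [hS, Nat.floor_div_natCast, Nat.div_eq_of_lt this]
  have hmain : HasSum (fun d : ℕ ↦ (moebiusCube d : ℝ) * ((X / d) ^ 3 / 3))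
      (X ^ 3 / (3 * (∑' n : ℕ, ((n : ℝ) ^ 3)⁻¹) ^ 3)) := by
    have h := hs3.hasSum.mul_left (X ^ 3 / 3)
    rw [tsum_moebiusCube_div_pow (by norm_num)] at h
    rw [← div_eq_mul_inv, div_div] at h
    have hterm : ∀ d : ℕ, X ^ 3 / 3 * ((moebiusCube d : ℝ) / (d : ℝ) ^ 3) =
        (moebiusCube d : ℝ) * ((X / d) ^ 3 / 3) := fun d ↦ by ring
    simpa only [hterm] using h
  rw [← (hsum.sub hmain).tsum_eq, Real.norm_of_nonneg (sq_nonneg X)]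
  refine tsum_of_norm_bounded (hs2.hasSum.mul_right (X ^ 2)) fun d ↦ ?_
  rw [← mul_sub, norm_mul, norm_div, norm_pow, RCLike.norm_natCast]
  calc _ ≤ ‖(moebiusCube d : ℝ)‖ * (X / d) ^ 2 := by
        gcongr
        exact abs_sum_Ioc_floor_sq_sub_le (by positivity)
    _ = _ := by ring
end

section
/- Let φ : ℝ → ℂ be a smooth (C^∞) function whose support is a compact subset of the open interval (1/2, 2), with Mellin transform φ̂(s) = ∫_0^∞ φ(x) x^{s} dx/x. For T ≥ 2 set φ_T(x) = T φ(x^T) and define 1_T(x) = ∫_0^∞ 1_{(0,1)}(x/y) φ_T(y) dy/y for x > 0. Then for every σ > 0 and every x > 0, the Mellin inversion formula holds: 1_T(x) = (1/2π) ∫_ℝ x^{-(σ+it)} φ̂((σ+it)/T) · (σ+it)^{-1} dt, i.e. 1_T(x) = (1/2πi) ∫_{Re(s)=σ} x^{-s} φ̂(s/T) ds/s, the integral converging absolutely. -/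
open Complex MeasureTheory
open Filter Topology Asymptotics

/-- A continuous function on `(0, ∞)` that is bounded near `0` and vanishes near `∞` has a
convergent Mellin transform on the right half-plane. -/
theorem mellinConvergent_of_eventuallyEq_zero {f : ℝ → ℂ} {s : ℂ} (hs : 0 < s.re)
    (hf : ContinuousOn f (Set.Ioi 0)) (htop : f =ᶠ[atTop] 0)
    (hzero : f =O[𝓝[>] 0] (fun _ => (1 : ℝ))) : MellinConvergent f s := by
  refine mellinConvergent_of_isBigO_rpow (a := s.re + 1) (b := 0)
    (hf.locallyIntegrableOn measurableSet_Ioi) ?_ (by linarith) (by simpa using hzero) hs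
  exact htop.trans_isBigO (isBigO_zero _ _)

/-- The Mellin transform of a continuous function on `(0, ∞)` that is bounded near `0` and vanishes
near `∞` is holomorphic on the right half-plane. -/
theorem mellin_differentiableAt_of_eventuallyEq_zero {f : ℝ → ℂ} {s : ℂ} (hs : 0 < s.re)
    (hf : ContinuousOn f (Set.Ioi 0)) (htop : f =ᶠ[atTop] 0)
    (hzero : f =O[𝓝[>] 0] (fun _ => (1 : ℝ))) : DifferentiableAt ℂ (mellin f) s := by
  refine mellin_differentiableAt_of_isBigO_rpow (a := s.re + 1) (b := 0)
    (hf.locallyIntegrableOn measurableSet_Ioi) ?_ (by linarith) (by simpa using hzero) hs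
  exact htop.trans_isBigO (isBigO_zero _ _)

/-- Integration by parts for the Mellin transform. -/
theorem mul_mellin_eq_neg_mellin_deriv {f f' : ℝ → ℂ} {s : ℂ} (hs : 0 < s.re)
    (hderiv : ∀ t ∈ Set.Ioi (0 : ℝ), HasDerivAt f (f' t) t) (hf' : ContinuousOn f' (Set.Ioi 0))
    (htop : f =ᶠ[atTop] 0) (hzero : f =O[𝓝[>] 0] (fun _ => (1 : ℝ)))
    (htop' : f' =ᶠ[atTop] 0) (hzero' : f' =O[𝓝[>] 0] (fun _ => (1 : ℝ))) :
    s * mellin f s = -mellin f' (s + 1) := by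
  have hs0 : s ≠ 0 := by rintro rfl; simp at hs
  have hc : MellinConvergent f s := mellinConvergent_of_eventuallyEq_zero hs
    (fun t ht => (hderiv t ht).continuousAt.continuousWithinAt) htop hzero
  have hc' : MellinConvergent f' (s + 1) := mellinConvergent_of_eventuallyEq_zero
    (by simp only [add_re, one_re]; linarith) hf' htop' hzero'
  have hlim0 : Tendsto (fun t : ℝ => (t : ℂ) ^ s * f t) (𝓝[>] 0) (𝓝 0) := by
    have h1 : Tendsto (fun t : ℝ => (t : ℂ) ^ s) (𝓝[>] 0) (𝓝 0) := by
      have := (continuous_ofReal_cpow_const hs).tendsto 0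
      simp only [ofReal_zero, zero_cpow hs0] at this
      exact this.mono_left nhdsWithin_le_nhds
    have h2 := ((isLittleO_one_iff ℝ).2 h1).mul_isBigO hzero
    simpa using h2
  have hlimtop : Tendsto (fun t : ℝ => (t : ℂ) ^ s * f t) atTop (𝓝 0) := by
    refine tendsto_const_nhds.congr' ?_
    filter_upwards [htop] with t ht
    simp [ht]
  have h1 : IntegrableOn (fun t : ℝ => s * (t : ℂ) ^ (s - 1) * f t) (Set.Ioi 0) := by
    simpa only [IntegrableOn, smul_eq_mul, mul_assoc] using hc.const_mul s
  have h2 : IntegrableOn (fun t : ℝ => (t : ℂ) ^ s * f' t) (Set.Ioi 0) := by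
    simpa only [MellinConvergent, smul_eq_mul, add_sub_cancel_right] using hc'
  have key := integral_Ioi_mul_deriv_eq_deriv_mul
    (fun t ht => hasDerivAt_ofReal_cpow_const (ne_of_gt ht) hs0) hderiv h2 h1 hlim0 hlimtop
  simp only [mul_assoc, integral_const_mul] at key
  simp only [mellin, smul_eq_mul, add_sub_cancel_right]
  linear_combination key

/-- The Mellin transform on a vertical line is bounded by a constant depending only on the real
part. -/
theorem exists_norm_mellin_le (f : ℝ → ℂ) (σ : ℝ) :
    ∃ C : ℝ, ∀ s : ℂ, s.re = σ → ‖mellin f s‖ ≤ C := by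
  refine ⟨∫ t in Set.Ioi (0 : ℝ), t ^ (σ - 1) * ‖f t‖, fun s hs => ?_⟩
  refine (norm_integral_le_integral_norm _).trans_eq ?_
  refine setIntegral_congr_fun measurableSet_Ioi fun t ht => ?_
  simp [norm_cpow_eq_rpow_re_of_pos ht, hs]

/-- The derivative of the tail integral `x ↦ ∫ y in Ioi x, g y`. -/
theorem hasDerivAt_integral_Ioi {g : ℝ → ℂ} {a x : ℝ} (hg : ContinuousOn g (Set.Ioi a))
    (hint : IntegrableOn g (Set.Ioi a)) (hx : a < x) :
    HasDerivAt (fun x => ∫ y in Set.Ioi x, g y) (-g x) x := by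
  have hI : IntervalIntegrable g volume a x :=
    (intervalIntegrable_iff_integrableOn_Ioc_of_le hx.le).2
      (hint.mono_set Set.Ioc_subset_Ioi_self)
  have h := intervalIntegral.integral_hasDerivAt_right hI
    (hg.stronglyMeasurableAtFilter isOpen_Ioi x hx) (hg.continuousAt (Ioi_mem_nhds hx))
  refine (h.const_sub (∫ y in Set.Ioi a, g y)).congr_of_eventuallyEq ?_
  filter_upwards [Ioi_mem_nhds hx] with z hz
  rw [← intervalIntegral.integral_Ioi_sub_Ioi hint (le_of_lt hz), sub_sub_cancel]

/-- The Mellin transform of a tail integral. -/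
theorem mellin_integral_Ioi {g : ℝ → ℂ} {s : ℂ} (hs : 0 < s.re)
    (hg : ContinuousOn g (Set.Ioi 0)) (htop : g =ᶠ[atTop] 0)
    (hzero : g =O[𝓝[>] 0] (fun _ => (1 : ℝ))) :
    HasMellin (fun x => ∫ y in Set.Ioi x, g y) s (mellin g (s + 1) / s) := by
  have hs0 : s ≠ 0 := by rintro rfl; simp at hs
  have hint : IntegrableOn g (Set.Ioi 0) := by
    simpa [MellinConvergent] using
      mellinConvergent_of_eventuallyEq_zero (s := 1) (by simp) hg htop hzero
  have hd : ∀ x ∈ Set.Ioi (0 : ℝ), HasDerivAt (fun x => ∫ y in Set.Ioi x, g y) ((-g) x) x :=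
    fun x hx => hasDerivAt_integral_Ioi hg hint hx
  have hFtop : (fun x => ∫ y in Set.Ioi x, g y) =ᶠ[atTop] 0 := by
    obtain ⟨b, hb⟩ := eventually_atTop.1 htop
    filter_upwards [eventually_ge_atTop b] with x hx
    exact setIntegral_eq_zero_of_forall_eq_zero fun y hy => hb y (hx.trans (le_of_lt hy))
  have hFzero : (fun x => ∫ y in Set.Ioi x, g y) =O[𝓝[>] 0] (fun _ => (1 : ℝ)) := by
    refine IsBigO.of_bound (∫ y in Set.Ioi (0 : ℝ), ‖g y‖) ?_
    filter_upwards [self_mem_nhdsWithin] with x hx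
    rw [norm_one, mul_one]
    exact (norm_integral_le_integral_norm _).trans <| setIntegral_mono_set hint.norm
      (Eventually.of_forall fun _ => norm_nonneg _)
      (Set.Ioi_subset_Ioi (le_of_lt hx)).eventuallyLE
  refine ⟨mellinConvergent_of_eventuallyEq_zero hs
    (fun x hx => (hd x hx).continuousAt.continuousWithinAt) hFtop hFzero, ?_⟩
  have h := mul_mellin_eq_neg_mellin_deriv hs hd hg.neg hFtop hFzero
    (by simpa using htop.neg) hzero.neg_left
  have hneg : mellin (-g) (s + 1) = -mellin g (s + 1) := by
    simp [mellin, integral_neg]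
  rw [hneg, neg_neg] at h
  rw [eq_div_iff hs0, mul_comm, h]

/-- The Mellin transform of a `C¹` function that vanishes near `∞` is `O(1 / |s|)` on vertical lines
in the right half-plane. -/
theorem exists_norm_mellin_le_div {f : ℝ → ℂ} (hf : ContDiff ℝ 1 f) (htop : f =ᶠ[atTop] 0)
    {σ : ℝ} (hσ : 0 < σ) : ∃ C : ℝ, ∀ s : ℂ, s.re = σ → ‖mellin f s‖ ≤ C / ‖s‖ := by
  obtain ⟨C, hC⟩ := exists_norm_mellin_le (deriv f) (σ + 1)
  refine ⟨C, fun s hs => ?_⟩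
  have hs' : 0 < s.re := hs ▸ hσ
  have hs0 : s ≠ 0 := by rintro rfl; simp at hs'
  have hbd : ∀ h : ℝ → ℂ, Continuous h → h =O[𝓝[>] 0] (fun _ => (1 : ℝ)) := fun h hh =>
    ((hh.tendsto 0).isBigO_one ℝ).mono nhdsWithin_le_nhds
  have htop' : deriv f =ᶠ[atTop] 0 := by
    obtain ⟨b, hb⟩ := eventually_atTop.1 htop
    filter_upwards [eventually_gt_atTop b] with x hx
    have : f =ᶠ[𝓝 x] fun _ => 0 := by
      filter_upwards [Ioi_mem_nhds hx] with y hy using hb y (le_of_lt hy)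
    simp [this.deriv_eq]
  have h := mul_mellin_eq_neg_mellin_deriv hs'
    (fun t _ => (hf.differentiable one_ne_zero t).hasDerivAt)
    (hf.continuous_deriv le_rfl).continuousOn htop (hbd _ hf.continuous) htop'
    (hbd _ (hf.continuous_deriv le_rfl))
  rw [le_div_iff₀ (norm_pos_iff.2 hs0), mul_comm, ← norm_mul, h, norm_neg]
  exact hC _ (by simp [hs])

/-- Mellin inversion for the smoothed indicator `1_T = 1_{(0,1)} ⋆ φ_T`: for every
`σ > 0` and `x > 0`,
`1_T(x) = (1/2π) ∫_ℝ x^{-(σ+it)} φ̂((σ+it)/T) (σ+it)⁻¹ dt`, the integral converging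
absolutely. -/
theorem smoothed_indicator_mellin_inversion
    (φ : ℝ → ℂ) (hφ : ContDiff ℝ (⊤ : ℕ∞) φ) (hsupp : tsupport φ ⊆ Set.Ioo (1 / 2 : ℝ) 2)
    (T : ℝ) (hT : 2 ≤ T)
    (oneT : ℝ → ℂ)
    (honeT : ∀ x : ℝ, oneT x = ∫ y in Set.Ioi (0 : ℝ),
      Set.indicator (Set.Ioo (0 : ℝ) 1) (fun _ => (1 : ℂ)) (x / y) *
        ((T : ℂ) * φ (y ^ T)) / y)
    (σ : ℝ) (hσ : 0 < σ) (x : ℝ) (hx : 0 < x) :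
    Integrable (fun t : ℝ =>
      (x : ℂ) ^ (-((σ : ℂ) + Complex.I * t)) *
        mellin φ (((σ : ℂ) + Complex.I * t) / (T : ℂ)) / ((σ : ℂ) + Complex.I * t)) ∧
    oneT x = (1 / (2 * Real.pi) : ℝ) • ∫ t : ℝ,
      (x : ℂ) ^ (-((σ : ℂ) + Complex.I * t)) *
        mellin φ (((σ : ℂ) + Complex.I * t) / (T : ℂ)) / ((σ : ℂ) + Complex.I * t) := by
  have hT0 : 0 < T := by linarith
  have hTC : (T : ℂ) ≠ 0 := ofReal_ne_zero.2 hT0.ne'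
  have hφ0 : ∀ t, t ∉ Set.Ioo (1 / 2 : ℝ) 2 → φ t = 0 := fun t ht =>
    image_eq_zero_of_notMem_tsupport fun h => ht (hsupp h)
  have hφ_top : φ =ᶠ[atTop] 0 := by
    filter_upwards [eventually_ge_atTop 2] with t ht using hφ0 t fun h => absurd h.2 (not_lt.2 ht)
  set g : ℝ → ℂ := fun y => (y : ℂ) ^ (-1 : ℂ) • ((T : ℂ) • φ (y ^ T)) with hg_def
  have hg_top : g =ᶠ[atTop] 0 := by
    filter_upwards [eventually_ge_atTop 2] with y hy
    have : (2 : ℝ) ≤ y ^ T :=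
      hy.trans (Real.self_le_rpow_of_one_le (by linarith) (by linarith))
    simp [hg_def, hφ0 _ fun h => absurd h.2 (not_lt.2 this)]
  have hg_zero : g =O[𝓝[>] 0] (fun _ => (1 : ℝ)) := by
    refine EventuallyEq.trans_isBigO (f₂ := fun _ => (0 : ℂ)) ?_ (isBigO_zero _ _)
    filter_upwards [Ioo_mem_nhdsGT (show (0 : ℝ) < 1 / 2 by norm_num)] with y hy
    have : y ^ T ≤ 1 / 2 :=
      (Real.rpow_le_self_of_le_one hy.1.le (by linarith [hy.2]) (by linarith)).trans hy.2.le
    simp [hg_def, hφ0 _ fun h => absurd h.1 (not_lt.2 this)]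
  have hg_cont : ContinuousOn g (Set.Ioi 0) := by
    refine ContinuousOn.smul (f := fun y : ℝ => (y : ℂ) ^ (-1 : ℂ)) (fun y hy => ?_) ?_
    · exact (continuousAt_ofReal_cpow_const y (-1)
        (Or.inr (ne_of_gt hy))).continuousWithinAt
    · exact ((hφ.continuous.comp (Real.continuous_rpow_const hT0.le)).const_smul
        (T : ℂ)).continuousOn
  have honeT' : ∀ x : ℝ, 0 < x → oneT x = ∫ y in Set.Ioi x, g y := by
    intro x hx
    have hind : ∫ y in Set.Ioi x, g y = ∫ y in Set.Ioi 0, (Set.Ioi x).indicator g y := by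
      rw [setIntegral_indicator measurableSet_Ioi,
        Set.inter_eq_right.2 (Set.Ioi_subset_Ioi hx.le)]
    rw [honeT, hind]
    refine setIntegral_congr_fun measurableSet_Ioi fun y hy => ?_
    have hy : 0 < y := hy
    by_cases hxy : x < y
    · have h1 : x / y ∈ Set.Ioo (0 : ℝ) 1 := ⟨div_pos hx hy, (div_lt_one hy).2 hxy⟩
      rw [Set.indicator_of_mem h1, Set.indicator_of_mem (Set.mem_Ioi.2 hxy), hg_def]
      simp [cpow_neg_one, div_eq_inv_mul]
    · have h1 : x / y ∉ Set.Ioo (0 : ℝ) 1 := fun h => hxy ((div_lt_one hy).1 h.2)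
      simp [h1, hxy]
  have hMg : ∀ s : ℂ, mellin g (s + 1) = mellin φ (s / T) := by
    intro s
    rw [hg_def, mellin_cpow_smul, mellin_const_smul, mellin_comp_rpow φ, abs_of_pos hT0]
    simp [hTC]
  have hM : ∀ s : ℂ, 0 < s.re →
      HasMellin (fun x => ∫ y in Set.Ioi x, g y) s (mellin φ (s / T) / s) := fun s hs =>
    hMg s ▸ mellin_integral_Ioi hs hg_cont hg_top hg_zero
  have hre : ∀ t : ℝ, ((σ : ℂ) + t * Complex.I).re = σ := by simp
  have hne : ∀ t : ℝ, (σ : ℂ) + t * Complex.I ≠ 0 := fun t h => by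
    have := hre t
    simp [h] at this
    exact hσ.ne this
  have hVI : VerticalIntegrable (mellin fun x => ∫ y in Set.Ioi x, g y) σ := by
    obtain ⟨C, hC⟩ := exists_norm_mellin_le_div (hφ.of_le (by exact_mod_cast le_top)) hφ_top
      (div_pos hσ hT0)
    have hVI' : Integrable fun t : ℝ =>
        mellin φ (((σ : ℂ) + t * Complex.I) / T) / ((σ : ℂ) + t * Complex.I) := by
      refine ((integrable_inv_one_add_sq.comp_div hσ.ne').const_mul (C * T / σ ^ 2)).mono' ?_ ?_
      · refine (Continuous.div ?_ (by fun_prop) hne).aestronglyMeasurable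
        refine continuous_iff_continuousAt.2 fun t => ?_
        have hline : Continuous fun t : ℝ => ((σ : ℂ) + t * Complex.I) / T := by fun_prop
        have hd : DifferentiableAt ℂ (mellin φ) (((σ : ℂ) + t * Complex.I) / T) :=
          mellin_differentiableAt_of_eventuallyEq_zero (by simpa using div_pos hσ hT0)
            hφ.continuous.continuousOn hφ_top
            (((hφ.continuous.tendsto 0).isBigO_one ℝ).mono nhdsWithin_le_nhds)
        exact hd.continuousAt.comp_of_eq hline.continuousAt rfl
      · refine Eventually.of_forall fun t => ?_
        have h := hC (((σ : ℂ) + t * Complex.I) / T) (by simp)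
        have hnorm : ‖(σ : ℂ) + t * Complex.I‖ ^ 2 = σ ^ 2 + t ^ 2 := by
          rw [← normSq_eq_norm_sq, normSq_add_mul_I]
        have hpos : 0 < ‖(σ : ℂ) + t * Complex.I‖ := norm_pos_iff.2 (hne t)
        rw [norm_div, norm_real, Real.norm_of_nonneg hT0.le] at h
        rw [norm_div]
        refine (div_le_div_of_nonneg_right h hpos.le).trans_eq ?_
        calc C / (‖(σ : ℂ) + t * Complex.I‖ / T) / ‖(σ : ℂ) + t * Complex.I‖
            = C * T / ‖(σ : ℂ) + t * Complex.I‖ ^ 2 := by field_simp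
          _ = C * T / σ ^ 2 * (1 + (t / σ) ^ 2)⁻¹ := by
            rw [hnorm]
            field_simp
    exact hVI'.congr (Eventually.of_forall fun t => (hM _ (by simpa using hσ)).2.symm)
  have hinv := mellinInv_mellin_eq σ _ hx (hM σ (by simpa)).1 hVI
    (hasDerivAt_integral_Ioi hg_cont (by
      simpa [MellinConvergent] using
        mellinConvergent_of_eventuallyEq_zero (s := 1) (by simp) hg_cont hg_top hg_zero)
      hx).continuousAt
  have hcongr : ∀ t : ℝ, (x : ℂ) ^ (-((σ : ℂ) + Complex.I * t)) *
        mellin φ (((σ : ℂ) + Complex.I * t) / (T : ℂ)) / ((σ : ℂ) + Complex.I * t) =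
      (x : ℂ) ^ (-((σ : ℂ) + t * Complex.I)) •
        mellin (fun x => ∫ y in Set.Ioi x, g y) (σ + t * Complex.I) := by
    intro t
    rw [(hM _ (by simpa using hσ)).2, mul_comm Complex.I, smul_eq_mul, mul_div_assoc]
  simp only [hcongr]
  refine ⟨?_, ?_⟩
  · refine hVI.bdd_mul (c := x ^ (-σ)) ?_ ?_
    · exact Continuous.aestronglyMeasurable (by
        refine Continuous.const_cpow (by fun_prop) (Or.inl (ofReal_ne_zero.2 hx.ne')))
    · exact Eventually.of_forall fun t => by simp [norm_cpow_eq_rpow_re_of_pos hx]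
  · rw [honeT' x hx, ← hinv]
    rfl
end
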